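/- arXiv:1904.06035 — 2 statements merged into one kernel-verified Lean document; each statement's English description precedes it below -/
import Mathlib

section
/- Let k be a field, R an associative unital k-algebra, and M, N finitely generated left R-modules. Then M ⇒_deg N if and only if there exist a finitely generated left R-module Z and a short exact sequence 0 → Z → M ⊕ Z → N → 0 of finitely generated left R-modules in which the second component ψ : Z → Z of the injective map Z → M ⊕ Z is a nilpotent endomorphism of Z. -/
open Polynomial TensorProduct

noncomputable section

/-- The prime ideal `(t)` of the polynomial ring `k[t]`. -/
def tIdeal (k : Type) [Field k] : Ideal (Polynomial k) := Ideal.span {Polynomial.X}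

instance tIdeal_isPrime (k : Type) [Field k] : (tIdeal k).IsPrime := by
  have h : tIdeal k = RingHom.ker (Polynomial.evalRingHom (0 : k)) := by
    rw [Polynomial.ker_evalRingHom]
    simp [tIdeal]
  rw [h]
  exact RingHom.ker_isPrime _

/-- `V = k[t]_{(t)}`, the localization of the polynomial ring `k[t]` at the prime ideal `(t)`. -/
def DegV (k : Type) [Field k] : Type := Localization.AtPrime (tIdeal k)

instance (k : Type) [Field k] : CommRing (DegV k) :=
  inferInstanceAs (CommRing (Localization.AtPrime (tIdeal k)))

instance (k : Type) [Field k] : Algebra (Polynomial k) (DegV k) :=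
  inferInstanceAs (Algebra (Polynomial k) (Localization.AtPrime (tIdeal k)))

instance (k : Type) [Field k] : Algebra k (DegV k) :=
  inferInstanceAs (Algebra k (Localization.AtPrime (tIdeal k)))

instance (k : Type) [Field k] : IsScalarTower k (Polynomial k) (DegV k) :=
  inferInstanceAs (IsScalarTower k (Polynomial k) (Localization.AtPrime (tIdeal k)))

/-- The element `t` of `V = k[t]_{(t)}`. -/
def degT (k : Type) [Field k] : DegV k := algebraMap (Polynomial k) (DegV k) Polynomial.X

/-- `K = V[t⁻¹]`, which is the fraction field `k(t)` of `V = k[t]_{(t)}`. -/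
def DegK (k : Type) [Field k] : Type := Localization (Submonoid.powers (degT k))

instance (k : Type) [Field k] : CommRing (DegK k) :=
  inferInstanceAs (CommRing (Localization (Submonoid.powers (degT k))))

instance (k : Type) [Field k] : Algebra (DegV k) (DegK k) :=
  inferInstanceAs (Algebra (DegV k) (Localization (Submonoid.powers (degT k))))

instance (k : Type) [Field k] : Algebra k (DegK k) :=
  inferInstanceAs (Algebra k (Localization (Submonoid.powers (degT k))))

/-- The localized module `Q[t⁻¹]` is a module over `K = V[t⁻¹]`. -/
instance (k : Type) [Field k] (Q : Type) [AddCommGroup Q] [Module (DegV k) Q] :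
    Module (DegK k) (LocalizedModule (Submonoid.powers (degT k)) Q) :=
  inferInstanceAs (Module (Localization (Submonoid.powers (degT k)))
    (LocalizedModule (Submonoid.powers (degT k)) Q))

section

variable (k : Type) [Field k] (R : Type) [Ring R] [Algebra k R]

/-- `1 ⊗ t` is central in `R ⊗[k] V`. -/
theorem degT_central (x : R ⊗[k] DegV k) :
    x * ((1 : R) ⊗ₜ[k] degT k) = ((1 : R) ⊗ₜ[k] degT k) * x := by
  induction x with
  | zero => simp
  | tmul a v => simp [Algebra.TensorProduct.tmul_mul_tmul, mul_comm]
  | add x y hx hy => simp [add_mul, mul_add, hx, hy]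

/-- Multiplication by `1 ⊗ t` on an `R ⊗[k] V`-module, as an `R ⊗[k] V`-linear map. -/
def tSmul (Q : Type) [AddCommGroup Q] [Module (R ⊗[k] DegV k) Q] :
    Q →ₗ[R ⊗[k] DegV k] Q where
  toFun q := ((1 : R) ⊗ₜ[k] degT k) • q
  map_add' := smul_add _
  map_smul' x q := by
    simp only [RingHom.id_apply, ← mul_smul, degT_central]

/-- The `R`-module structure on an `R ⊗[k] V`-module obtained by restriction of scalars
along `R → R ⊗[k] V`. -/
def rRestrict (Q : Type) [AddCommGroup Q] [Module (R ⊗[k] DegV k) Q] : Module R Q :=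
  Module.compHom Q (Algebra.TensorProduct.includeLeftRingHom : R →+* R ⊗[k] DegV k)

/-- The `V`-module structure on an `R ⊗[k] V`-module obtained by restriction of scalars
along `V → R ⊗[k] V`. -/
def vRestrict (Q : Type) [AddCommGroup Q] [Module (R ⊗[k] DegV k) Q] : Module (DegV k) Q :=
  Module.compHom Q
    ((Algebra.TensorProduct.includeRight : DegV k →ₐ[k] R ⊗[k] DegV k) : DegV k →+* R ⊗[k] DegV k)

/-- The action of `r : R` on an `R ⊗[k] V`-module `Q`, as a `V`-linear endomorphism of `Q`. -/
def rAct (Q : Type) [AddCommGroup Q] [Module (R ⊗[k] DegV k) Q] (r : R) :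
    letI := vRestrict k R Q
    Q →ₗ[DegV k] Q :=
  letI := vRestrict k R Q
  { toFun := fun q => (r ⊗ₜ[k] (1 : DegV k)) • q
    map_add' := smul_add _
    map_smul' := fun v q => by
      show (r ⊗ₜ[k] (1 : DegV k)) • (((1 : R) ⊗ₜ[k] v) • q)
        = ((1 : R) ⊗ₜ[k] v) • ((r ⊗ₜ[k] (1 : DegV k)) • q)
      rw [← mul_smul, ← mul_smul, Algebra.TensorProduct.tmul_mul_tmul,
        Algebra.TensorProduct.tmul_mul_tmul, one_mul, mul_one, one_mul, mul_one] }

/-- The action of `r : R` on a module `M`, as a `k`-linear endomorphism of `M`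
(where `M` is viewed as a `k`-module by restriction of scalars along `k → R`). -/
def rActK (M : Type) [AddCommGroup M] [Module R M] (r : R) :
    letI := Module.compHom M (algebraMap k R)
    M →ₗ[k] M :=
  letI := Module.compHom M (algebraMap k R)
  { toFun := fun m => r • m
    map_add' := smul_add r
    map_smul' := fun c m => by
      show r • ((algebraMap k R c) • m) = (algebraMap k R c) • (r • m)
      rw [← mul_smul, ← mul_smul, Algebra.commutes] }

/-- Degeneration of modules (Yoshino): `M ⇒_deg N` iff there is a finitely generated
`R ⊗[k] V`-module `Q`, flat over `V`, with `Q/tQ ≅ N` as `R`-modules and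
`Q_t = Q[t⁻¹] ≅ M ⊗[k] K` compatibly with the `R`- and `K`-actions
(i.e. as `R ⊗[k] K`-modules). -/
def Degenerates (M N : Type) [AddCommGroup M] [Module R M] [AddCommGroup N] [Module R N] :
    Prop :=
  ∃ (Q : Type) (_ : AddCommGroup Q) (_ : Module (R ⊗[k] DegV k) Q),
    Module.Finite (R ⊗[k] DegV k) Q ∧
    (letI := vRestrict k R Q; Module.Flat (DegV k) Q) ∧
    -- `Q/tQ ≅ N` as `R`-modules
    (letI := rRestrict k R (Q ⧸ LinearMap.range (tSmul k R Q))
     Nonempty ((Q ⧸ LinearMap.range (tSmul k R Q)) ≃ₗ[R] N)) ∧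
    -- `Q_t ≅ M ⊗_k K` as `R ⊗_k K`-modules, i.e. compatibly with both actions
    (letI := vRestrict k R Q
     letI : Module k M := Module.compHom M (algebraMap k R)
     ∃ f : LocalizedModule (Submonoid.powers (degT k)) Q ≃+ (M ⊗[k] DegK k),
       (∀ (c : DegK k) (x : LocalizedModule (Submonoid.powers (degT k)) Q),
          f (c • x) = LinearMap.lTensor M (LinearMap.mulLeft k c) (f x)) ∧
       (∀ (r : R) (x : LocalizedModule (Submonoid.powers (degT k)) Q),
          f (LocalizedModule.map (Submonoid.powers (degT k)) (rAct k R Q r) x)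
            = LinearMap.rTensor (DegK k) (rActK k R M r) (f x)))

end

section VK

variable (k : Type) [Field k]

instance degV_isLoc : IsLocalization.AtPrime (DegV k) (tIdeal k) :=
  inferInstanceAs (IsLocalization.AtPrime (Localization.AtPrime (tIdeal k)) (tIdeal k))

instance degK_isLoc : IsLocalization (Submonoid.powers (degT k)) (DegK k) :=
  inferInstanceAs (IsLocalization (Submonoid.powers (degT k))
    (Localization (Submonoid.powers (degT k))))

instance degVK_tower : IsScalarTower k (DegV k) (DegK k) :=
  inferInstanceAs (IsScalarTower k (DegV k) (Localization (Submonoid.powers (degT k))))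

instance degV_isDomain : IsDomain (DegV k) :=
  inferInstanceAs (IsDomain (Localization.AtPrime (tIdeal k)))

instance degV_isDedekind : IsDedekindDomain (DegV k) :=
  IsLocalization.AtPrime.isDedekindDomain k[X] (tIdeal k) _

theorem tIdeal_compl_iff (p : k[X]) : p ∈ (tIdeal k).primeCompl ↔ p.eval 0 ≠ 0 := by
  rw [Ideal.mem_primeCompl_iff, tIdeal, Ideal.mem_span_singleton, Polynomial.X_dvd_iff,
    Polynomial.coeff_zero_eq_eval_zero]

/-- Evaluation at `t = 0`. -/
def evV : DegV k →+* k :=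
  IsLocalization.lift (M := (tIdeal k).primeCompl) (g := Polynomial.evalRingHom (0 : k))
    (fun y => by
      have := (tIdeal_compl_iff k y).1 y.2
      simpa using this)

theorem evV_algebraMap (p : k[X]) : evV k (algebraMap _ _ p) = p.eval 0 := by
  simp [evV]

theorem evV_t : evV k (degT k) = 0 := by
  rw [degT, evV_algebraMap]; simp

theorem evV_k (a : k) : evV k (algebraMap k (DegV k) a) = a := by
  rw [IsScalarTower.algebraMap_apply k k[X] (DegV k), evV_algebraMap]; simp

/-- Evaluation at `t = 0`, linear over `k`. -/
def evVl : DegV k →ₗ[k] k where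
  toFun := evV k
  map_add' := map_add _
  map_smul' c v := by rw [Algebra.smul_def, map_mul, evV_k]; rfl

theorem evV_zero {v : DegV k} (h : evV k v = 0) : ∃ v', v = degT k * v' := by
  obtain ⟨p, s, rfl⟩ := IsLocalization.exists_mk'_eq (tIdeal k).primeCompl v
  have hs := IsLocalization.mk'_spec (DegV k) p s
  have h2 := congrArg (evV k) hs
  rw [map_mul, h, zero_mul, evV_algebraMap] at h2
  obtain ⟨q, rfl⟩ : Polynomial.X ∣ p := by
    rw [Polynomial.X_dvd_iff, Polynomial.coeff_zero_eq_eval_zero, ← h2]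
  refine ⟨IsLocalization.mk' _ q s, ?_⟩
  rw [degT, IsLocalization.mul_mk'_eq_mk'_of_mul]

theorem evV_decomp (v : DegV k) : ∃ v', v = algebraMap k _ (evV k v) + degT k * v' := by
  obtain ⟨v', h⟩ := evV_zero k (v := v - algebraMap k _ (evV k v)) (by simp [evV_k])
  exact ⟨v', by rw [← h]; ring⟩

theorem degT_ne : degT k ≠ 0 := by
  intro h
  have : Function.Injective (algebraMap k[X] (DegV k)) :=
    IsLocalization.injective _ (Ideal.primeCompl_le_nonZeroDivisors (tIdeal k))
  exact Polynomial.X_ne_zero (this (by rw [map_zero]; exact h))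

theorem VK_inj : Function.Injective (algebraMap (DegV k) (DegK k)) :=
  IsLocalization.injective (M := Submonoid.powers (degT k)) _
    (powers_le_nonZeroDivisors_of_noZeroDivisors (degT_ne k))

/-- The element `t` of `K`. -/
def tK : DegK k := algebraMap _ _ (degT k)

theorem tK_unit : IsUnit (tK k) :=
  IsLocalization.map_units (M := Submonoid.powers (degT k)) _ ⟨degT k, 1, by simp⟩

/-- The inverse of `t`. -/
def tInv : DegK k := ((tK_unit k).unit⁻¹ : (DegK k)ˣ)

theorem tK_mul_tInv : tK k * tInv k = 1 := (tK_unit k).mul_val_inv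

theorem K_surj (c : DegK k) : ∃ (n : ℕ) (v : DegV k), tK k ^ n * c = algebraMap _ _ v := by
  obtain ⟨v, ⟨_, n, rfl⟩, h⟩ := IsLocalization.exists_mk'_eq (Submonoid.powers (degT k)) c
  refine ⟨n, v, ?_⟩
  rw [← h, tK, ← map_pow]
  exact IsLocalization.mk'_spec' (M := Submonoid.powers (degT k)) (DegK k) v ⟨(degT k)^n, n, rfl⟩

theorem VK_unit {v : DegV k} (hv : v ≠ 0) : IsUnit (algebraMap _ (DegK k) v) := by
  obtain ⟨p, s, rfl⟩ := IsLocalization.exists_mk'_eq (tIdeal k).primeCompl v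
  have hs := IsLocalization.mk'_spec (DegV k) p s
  set v := IsLocalization.mk' (DegV k) p s
  have hp : p ≠ 0 := by
    rintro rfl
    rw [map_zero] at hs
    exact (mul_ne_zero hv (IsLocalization.map_units (DegV k) s).ne_zero) hs
  obtain ⟨q, hpq, hq⟩ := Polynomial.exists_eq_pow_rootMultiplicity_mul_and_not_dvd p hp 0
  rw [map_zero, sub_zero] at hpq hq
  have hq' : q ∈ (tIdeal k).primeCompl := by
    rw [Ideal.mem_primeCompl_iff, tIdeal, Ideal.mem_span_singleton]; exact hq
  have h3 := congrArg (algebraMap (DegV k) (DegK k)) hs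
  rw [map_mul] at h3
  refine isUnit_of_mul_isUnit_left (y := algebraMap (DegV k) (DegK k) (algebraMap _ _ s.1)) ?_
  rw [h3, hpq, map_mul, map_mul, map_pow, map_pow]
  exact ((tK_unit k).pow _).mul ((IsLocalization.map_units (DegV k) ⟨q, hq'⟩).map _)

/-- A `k`-linear functional on `K` extending evaluation at zero. -/
theorem exists_lam : ∃ l : DegK k →ₗ[k] k, ∀ v, l (algebraMap (DegV k) _ v) = evV k v := by
  obtain ⟨g, hg⟩ := LinearMap.exists_leftInverse_of_injective
    (IsScalarTower.toAlgHom k (DegV k) (DegK k)).toLinearMap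
    (LinearMap.ker_eq_bot.2 (VK_inj k))
  refine ⟨evVl k ∘ₗ g, fun v => ?_⟩
  have := LinearMap.congr_fun hg v
  change evV k (g (algebraMap _ _ v)) = _
  congr 1

end VK

section Core

variable {R M N W : Type} [Ring R] [AddCommGroup M] [Module R M] [AddCommGroup N] [Module R N]
  [AddCommGroup W] [Module R W]

theorem linprod_apply {A B C : Type} [AddCommGroup A] [Module R A] [AddCommGroup B] [Module R B]
    [AddCommGroup C] [Module R C] (f : A →ₗ[R] B) (g : A →ₗ[R] C) (x : A) :
    f.prod g x = (f x, g x) := rfl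

theorem core1 (L P : Submodule R W) (T : W →ₗ[R] W) (hT : Function.Injective T) (hLP : L ≤ P)
    (hTP : ∀ x ∈ P, T x ∈ P) (hTL : ∀ x ∈ L, T x ∈ L) (l : W →ₗ[R] M) (i : M →ₗ[R] W)
    (hli : ∀ m, l (i m) = m) (hi : ∀ m, i m ∈ L) (hdec : ∀ x ∈ L, ∃ y ∈ L, x = i (l x) + T y)
    (hlT : ∀ y ∈ L, l (T y) = 0) (n : ℕ) (hn : ∀ x ∈ P, (T ^ n) x ∈ L)
    (hfg : Module.Finite R (P ⧸ L.submoduleOf P)) (p : P →ₗ[R] N) (hps : Function.Surjective p)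
    (hp : ∀ x : P, p x = 0 ↔ ∃ y ∈ P, (x : W) = T y) :
    ∃ (Z : Type) (_ : AddCommGroup Z) (_ : Module R Z), Module.Finite R Z ∧
        ∃ (φ : Z →ₗ[R] M) (ψ : Z →ₗ[R] Z) (g : M × Z →ₗ[R] N),
          Function.Injective ⇑(φ.prod ψ) ∧ Function.Surjective ⇑g ∧
          LinearMap.range (φ.prod ψ) = LinearMap.ker g ∧
          IsNilpotent (ψ : Module.End R Z) := by
  let T' : P →ₗ[R] P := T.restrict hTP
  have hT' : ∀ x, ((T' x : P) : W) = T x := fun x => rfl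
  let i' : M →ₗ[R] P := i.codRestrict P (fun m => hLP (hi m))
  have hi' : ∀ x, ((i' x : P) : W) = i x := fun x => rfl
  let φ : (P ⧸ L.submoduleOf P) →ₗ[R] M := (L.submoduleOf P).liftQ (l ∘ₗ P.subtype ∘ₗ T') (by
    intro x hx
    exact hlT _ hx)
  let ψ : (P ⧸ L.submoduleOf P) →ₗ[R] (P ⧸ L.submoduleOf P) :=
    (L.submoduleOf P).mapQ (L.submoduleOf P) T' (by
      intro x hx
      exact hTL _ hx)
  let g₂ : (P ⧸ L.submoduleOf P) →ₗ[R] N := (L.submoduleOf P).liftQ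
    (p ∘ₗ (LinearMap.id - i' ∘ₗ l ∘ₗ P.subtype)) (by
      intro x hx
      obtain ⟨y, hy, h⟩ := hdec x hx
      refine (hp _).2 ⟨y, hLP hy, ?_⟩
      change (x : W) - i (l x) = T y
      rw [sub_eq_iff_eq_add, add_comm]
      exact h)
  have hg₂ : ∀ x, g₂ (Submodule.Quotient.mk x) = p (x - i' (l x)) := fun x => rfl
  have hφ : ∀ x : P, φ (Submodule.Quotient.mk x) = l (T x) := fun x => rfl
  have hψ : ∀ x : P, ψ (Submodule.Quotient.mk x) = Submodule.Quotient.mk (T' x) := fun x => rfl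
  refine ⟨P ⧸ L.submoduleOf P, inferInstance, inferInstance, hfg, φ, ψ,
    (p ∘ₗ i').coprod g₂, ?_, ?_, ?_, ?_⟩
  · rw [← LinearMap.ker_eq_bot, LinearMap.ker_eq_bot']
    intro z
    induction z using Submodule.Quotient.induction_on with
    | H x =>
    intro h
    rw [linprod_apply, Prod.mk_eq_zero, hφ, hψ,
      Submodule.Quotient.mk_eq_zero] at h
    obtain ⟨y, hy, e⟩ := hdec _ h.2
    change T x = i (l (T x)) + T y at e
    rw [h.1, map_zero, zero_add] at e
    rw [Submodule.Quotient.mk_eq_zero]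
    change (x : W) ∈ L
    rw [hT e]
    exact hy
  · intro y
    obtain ⟨x, rfl⟩ := hps y
    refine ⟨(l x, Submodule.Quotient.mk x), ?_⟩
    rw [LinearMap.coprod_apply, hg₂]
    simp
  · apply le_antisymm
    · rintro _ ⟨z, rfl⟩
      induction z using Submodule.Quotient.induction_on with
      | H x =>
      rw [LinearMap.mem_ker, linprod_apply, LinearMap.coprod_apply, hφ, hψ, hg₂]
      simp only [LinearMap.comp_apply, hT', map_sub, add_sub_cancel]
      exact (hp _).2 ⟨x, x.2, rfl⟩
    · rintro ⟨m, z⟩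
      induction z using Submodule.Quotient.induction_on with
      | H x =>
      intro h
      rw [LinearMap.mem_ker, LinearMap.coprod_apply, hg₂, LinearMap.comp_apply, ← map_add, hp] at h
      obtain ⟨y, hy, e⟩ := h
      change i m + ((x : W) - i (l x)) = T y at e
      have e2 := congrArg l e
      simp only [map_add, map_sub, hli] at e2
      refine ⟨Submodule.Quotient.mk ⟨y, hy⟩, ?_⟩
      rw [linprod_apply, hφ, hψ, Prod.mk.injEq]
      constructor
      · rw [← e2]; abel
      · rw [Submodule.Quotient.eq]
        change T y - (x : W) ∈ L
        have : T y - (x : W) = i m - i (l x) := by rw [← e]; abel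
        rw [this]
        exact L.sub_mem (hi _) (hi _)
  · refine ⟨n, ?_⟩
    have key : ∀ (j : ℕ) (x : P), (ψ ^ j) (Submodule.Quotient.mk x)
        = Submodule.Quotient.mk ((T' ^ j) x) ∧ (((T' ^ j) x : P) : W) = (T ^ j) x := by
      intro j
      induction j with
      | zero => intro x; exact ⟨rfl, rfl⟩
      | succ j ih =>
        intro x
        rw [pow_succ', pow_succ', pow_succ', Module.End.mul_apply, Module.End.mul_apply,
          Module.End.mul_apply, (ih x).1, hψ, hT', (ih x).2]
        exact ⟨rfl, rfl⟩
    ext z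
    rw [LinearMap.comp_apply, Submodule.mkQ_apply, (key n z).1]
    change _ = (0 : P ⧸ L.submoduleOf P)
    rw [Submodule.Quotient.mk_eq_zero]
    change (((T' ^ n) z : P) : W) ∈ L
    rw [(key n z).2]
    exact hn _ z.2

theorem core2 {Z : Type} [AddCommGroup Z] [Module R Z]
    (φ : Z →ₗ[R] M) (ψ : Z →ₗ[R] Z) (g : M × Z →ₗ[R] N)
    (hinj : Function.Injective ⇑(φ.prod ψ)) (hsurj : Function.Surjective ⇑g)
    (hex : LinearMap.range (φ.prod ψ) = LinearMap.ker g) (hnil : IsNilpotent (ψ : Module.End R Z))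
    (L : Submodule R W) (T : W →ₗ[R] W) (hT : Function.Injective T)
    (l : W →ₗ[R] M) (i : M →ₗ[R] W)
    (hli : ∀ m, l (i m) = m) (hi : ∀ m, i m ∈ L) (hdec : ∀ x ∈ L, ∃ y ∈ L, x = i (l x) + T y)
    (hTL : ∀ x ∈ L, T x ∈ L) (hlT : ∀ y ∈ L, l (T y) = 0)
    (S : Z →ₗ[R] W) (hS : ∀ z, T (S z) = i (φ z) + S (ψ z)) :
    ∃ p : ↥(L ⊔ LinearMap.range S) →ₗ[R] N, Function.Surjective p ∧
      ∀ x, p x = 0 ↔ ∃ y ∈ L ⊔ LinearMap.range S, (x : W) = T y := by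
  obtain ⟨n, hn⟩ := hnil
  have hSL : ∀ (j : ℕ) (z : Z), (ψ ^ j : Module.End R Z) z = 0 → S z ∈ L → z = 0 := by
    intro j
    induction j with
    | zero => intro z hz _; exact hz
    | succ j ih =>
      intro z hz hzL
      have h1 := hS z
      have h2 : S (ψ z) ∈ L := by
        have : S (ψ z) = T (S z) - i (φ z) := by rw [h1]; abel
        rw [this]
        exact L.sub_mem (hTL _ hzL) (hi _)
      have h3 : ψ z = 0 := ih _ (by rw [pow_succ] at hz; exact hz) h2
      have h4 := congrArg l h1
      rw [h3, hlT _ hzL, map_zero, add_zero, hli] at h4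
      apply hinj
      rw [map_zero]
      exact Prod.ext h4.symm h3
  have hSL' : ∀ z, S z ∈ L → z = 0 := fun z => hSL n z (by rw [hn]; rfl)
  let h : L × Z →ₗ[R] ↥(L ⊔ LinearMap.range S) :=
    (L.subtype.coprod S).codRestrict _ (by
      rintro ⟨x, z⟩
      exact Submodule.add_mem_sup x.2 ⟨z, rfl⟩)
  have hh : ∀ x, ((h x : ↥(L ⊔ LinearMap.range S)) : W) = x.1 + S x.2 := fun x => rfl
  have hb : Function.Bijective h := by
    constructor
    · rw [← LinearMap.ker_eq_bot, LinearMap.ker_eq_bot']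
      rintro ⟨x, z⟩ e
      have e2 := congrArg Subtype.val e
      rw [hh] at e2
      change (x : W) + S z = 0 at e2
      have hz : z = 0 := hSL' z (by
        rw [eq_neg_of_add_eq_zero_right e2]
        exact L.neg_mem x.2)
      subst hz
      rw [map_zero, add_zero] at e2
      ext
      · exact e2
      · rfl
    · rintro ⟨y, hy⟩
      obtain ⟨x, hx, _, ⟨z, rfl⟩, e⟩ := Submodule.mem_sup.1 hy
      exact ⟨(⟨x, hx⟩, z), Subtype.ext e⟩
  let e := LinearEquiv.ofBijective h hb
  let q : L × Z →ₗ[R] N := g ∘ₗ ((l ∘ₗ L.subtype).prodMap LinearMap.id)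
  have hq : ∀ x z, q (x, z) = g (l x, z) := fun _ _ => rfl
  have hTi : ∀ m, T (i m) ∈ L := fun m => hTL _ (hi m)
  refine ⟨q ∘ₗ e.symm.toLinearMap, ?_, ?_⟩
  · intro y
    obtain ⟨⟨m, z⟩, rfl⟩ := hsurj y
    refine ⟨e (⟨i m, hi m⟩, z), ?_⟩
    change q (e.symm (e _)) = _
    rw [LinearEquiv.symm_apply_apply, hq, hli]
  · intro w
    obtain ⟨⟨x, z⟩, rfl⟩ := e.surjective w
    change q (e.symm (e (x, z))) = 0 ↔ _
    rw [LinearEquiv.symm_apply_apply, hq]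
    change _ ↔ ∃ y ∈ _, (x : W) + S z = T y
    constructor
    · intro hg
      rw [← LinearMap.mem_ker, ← hex] at hg
      obtain ⟨w, hw⟩ := hg
      rw [linprod_apply, Prod.mk.injEq] at hw
      obtain ⟨y, hy, e⟩ := hdec x x.2
      refine ⟨y + S w, Submodule.add_mem_sup hy ⟨w, rfl⟩, ?_⟩
      rw [map_add, hS, e, hw.1, hw.2]
      abel
    · rintro ⟨y, hy, e⟩
      obtain ⟨a, ha, _, ⟨w, rfl⟩, rfl⟩ := Submodule.mem_sup.1 hy
      rw [map_add, hS] at e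
      have h1 : ψ w = z := by
        rw [← sub_eq_zero]
        apply hSL'
        have : S (ψ w - z) = x - (T a + i (φ w)) := by
          rw [map_sub, sub_eq_sub_iff_add_eq_add, e]; abel
        rw [this]
        exact L.sub_mem x.2 (L.add_mem (hTL _ ha) (hi _))
      subst h1
      have h2 : (x : W) = T a + i (φ w) := by
        apply add_right_cancel (b := S (ψ w)); rw [e]; abel
      have h3 := congrArg l h2
      rw [map_add, hlT _ ha, hli, zero_add] at h3
      rw [h3, ← LinearMap.mem_ker, ← hex]
      exact ⟨w, rfl⟩

end Core

section Conc

variable (k : Type) [Field k] (R : Type) [Ring R] [Algebra k R]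
  (M : Type) [AddCommGroup M] [Module R M] [Module k M] [IsScalarTower k R M]

/-- The action of `K` on `M ⊗ K` by `R`-linear endomorphisms. -/
def cA : DegK k →+* Module.End R (M ⊗[k] DegK k) where
  toFun c := TensorProduct.AlgebraTensorModule.map (LinearMap.id : M →ₗ[R] M) (LinearMap.mulLeft k c)
  map_one' := by ext; simp
  map_mul' a b := by ext; simp
  map_zero' := by ext; simp
  map_add' a b := by ext; simp [add_mul, TensorProduct.tmul_add]

@[simp] theorem cA_tmul (c : DegK k) (m : M) (x : DegK k) :
    cA k R M c (m ⊗ₜ x) = m ⊗ₜ (c * x) := rfl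

theorem cA_eq (c : DegK k) (w : M ⊗[k] DegK k) :
    cA k R M c w = LinearMap.lTensor M (LinearMap.mulLeft k c) w := rfl

theorem cA_cA (c d : DegK k) (w : M ⊗[k] DegK k) :
    cA k R M c (cA k R M d w) = cA k R M (c * d) w := by rw [map_mul]; rfl

theorem cA_k (a : k) (w : M ⊗[k] DegK k) :
    cA k R M (algebraMap k _ a) w = algebraMap k R a • w := by
  induction w with
  | zero => simp
  | add x y hx hy => rw [map_add, hx, hy, smul_add]
  | tmul m c =>
    rw [cA_tmul, TensorProduct.smul_tmul', algebraMap_smul, ← Algebra.smul_def,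
      TensorProduct.smul_tmul]

theorem cA_inj {c : DegK k} (hc : IsUnit c) : Function.Injective (cA k R M c) := by
  obtain ⟨d, hd⟩ := hc.exists_left_inv
  intro x y h
  have := congrArg (cA k R M d) h
  rwa [cA_cA, cA_cA, hd, map_one] at this

/-- The embedding `m ↦ m ⊗ 1`. -/
def iot : M →ₗ[R] M ⊗[k] DegK k where
  toFun m := m ⊗ₜ 1
  map_add' a b := TensorProduct.add_tmul _ _ _
  map_smul' r m := rfl

/-- The retraction onto `M` given by a functional. -/
def lam (l : DegK k →ₗ[k] k) : M ⊗[k] DegK k →ₗ[R] M :=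
  (TensorProduct.AlgebraTensorModule.rid k R M).toLinearMap ∘ₗ
    TensorProduct.AlgebraTensorModule.map LinearMap.id l

theorem lam_tmul (l : DegK k →ₗ[k] k) (m : M) (c : DegK k) :
    lam k R M l (m ⊗ₜ c) = l c • m := by
  simp [lam]

/-- The lattice `M ⊗ V`. -/
def LL : Submodule R (M ⊗[k] DegK k) :=
  LinearMap.range (TensorProduct.AlgebraTensorModule.map (LinearMap.id : M →ₗ[R] M)
    (IsScalarTower.toAlgHom k (DegV k) (DegK k)).toLinearMap)

theorem LL_mem (m : M) (v : DegV k) : m ⊗ₜ[k] algebraMap _ (DegK k) v ∈ LL k R M :=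
  ⟨m ⊗ₜ v, rfl⟩

theorem LL_ind {p : M ⊗[k] DegK k → Prop} (h0 : p 0)
    (hadd : ∀ x ∈ LL k R M, ∀ y ∈ LL k R M, p x → p y → p (x + y))
    (ht : ∀ m v, p (m ⊗ₜ[k] algebraMap (DegV k) _ v)) : ∀ x ∈ LL k R M, p x := by
  rintro _ ⟨y, rfl⟩
  induction y with
  | zero => rwa [map_zero]
  | tmul m v => exact ht m v
  | add a b ha hb => rw [map_add]; exact hadd _ ⟨a, rfl⟩ _ ⟨b, rfl⟩ ha hb

theorem LL_cA (v : DegV k) : ∀ x ∈ LL k R M, cA k R M (algebraMap _ _ v) x ∈ LL k R M := by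
  apply LL_ind
  · rw [map_zero]; exact Submodule.zero_mem _
  · intro x _ y _ hx hy; rw [map_add]; exact Submodule.add_mem _ hx hy
  · intro m v'; rw [cA_tmul, ← map_mul]; exact LL_mem _ _ _ _ _

theorem LL_T : ∀ x ∈ LL k R M, cA k R M (tK k) x ∈ LL k R M := LL_cA k R M (degT k)

theorem iot_mem (m : M) : iot k R M m ∈ LL k R M := by
  have := LL_mem k R M m 1
  rwa [map_one] at this

theorem lam_iot {l : DegK k →ₗ[k] k} (hl : ∀ v, l (algebraMap (DegV k) _ v) = evV k v) (m : M) :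
    lam k R M l (iot k R M m) = m := by
  have := hl 1
  rw [map_one (algebraMap (DegV k) (DegK k)), map_one (evV k)] at this
  change lam k R M l (m ⊗ₜ 1) = m
  rw [lam_tmul, this, one_smul]

theorem lam_T {l : DegK k →ₗ[k] k} (hl : ∀ v, l (algebraMap (DegV k) _ v) = evV k v) :
    ∀ y ∈ LL k R M, lam k R M l (cA k R M (tK k) y) = 0 := by
  apply LL_ind
  · simp
  · intro x _ y _ hx hy; rw [map_add, map_add, hx, hy, add_zero]
  · intro m v
    rw [cA_tmul, tK, ← map_mul, lam_tmul, hl, map_mul, evV_t, zero_mul, zero_smul]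

theorem LL_dec {l : DegK k →ₗ[k] k} (hl : ∀ v, l (algebraMap (DegV k) _ v) = evV k v) :
    ∀ x ∈ LL k R M, ∃ y ∈ LL k R M,
      x = iot k R M (lam k R M l x) + cA k R M (tK k) y := by
  apply LL_ind
  · exact ⟨0, Submodule.zero_mem _, by simp⟩
  · rintro x _ y _ ⟨a, ha, hx⟩ ⟨b, hb, hy⟩
    refine ⟨a + b, Submodule.add_mem _ ha hb, ?_⟩
    simp only [map_add]
    nth_rewrite 1 [hx, hy]
    abel
  · intro m v
    obtain ⟨v', hv⟩ := evV_decomp k v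
    refine ⟨m ⊗ₜ algebraMap _ _ v', LL_mem _ _ _ _ _, ?_⟩
    rw [lam_tmul, hl, cA_tmul, tK, ← map_mul]
    change _ = (evV k v • m) ⊗ₜ[k] (1 : DegK k) + _
    rw [TensorProduct.smul_tmul, ← TensorProduct.tmul_add]
    congr 1
    rw [Algebra.smul_def, mul_one, IsScalarTower.algebraMap_apply k (DegV k) (DegK k), ← map_add,
      ← hv]

theorem W_pow (w : M ⊗[k] DegK k) : ∃ n : ℕ, ∀ m, n ≤ m → cA k R M (tK k ^ m) w ∈ LL k R M := by
  induction w with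
  | zero => exact ⟨0, fun m _ => by rw [map_zero]; exact Submodule.zero_mem _⟩
  | add x y hx hy =>
    obtain ⟨a, ha⟩ := hx
    obtain ⟨b, hb⟩ := hy
    refine ⟨max a b, fun m hm => ?_⟩
    rw [map_add]
    exact Submodule.add_mem _ (ha m (le_of_max_le_left hm)) (hb m (le_of_max_le_right hm))
  | tmul x c =>
    obtain ⟨n, v, h⟩ := K_surj k c
    refine ⟨n, fun m hm => ?_⟩
    obtain ⟨d, rfl⟩ := Nat.exists_eq_add_of_le hm
    rw [cA_tmul, add_comm n d, pow_add, mul_assoc, h, tK, ← map_pow, ← map_mul]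
    exact LL_mem _ _ _ _ _

theorem unif {α : Type} (s : Finset α) (p : ℕ → α → Prop)
    (h : ∀ a, ∃ n, ∀ m, n ≤ m → p m a) : ∃ n, ∀ a ∈ s, p n a := by
  choose f hf using h
  exact ⟨s.sup f, fun a ha => hf a _ (Finset.le_sup ha)⟩

theorem cA_T_pow (n : ℕ) (w : M ⊗[k] DegK k) :
    ((cA k R M (tK k)) ^ n) w = cA k R M (tK k ^ n) w := by rw [map_pow]

end Conc

section Fwd

variable (k : Type) [Field k] (R : Type) [Ring R] [Algebra k R]
  (M : Type) [AddCommGroup M] [Module R M] [Module k M] [IsScalarTower k R M]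
  [Module.Finite R M] (N : Type) [AddCommGroup N] [Module R N]

/-- Forward direction, for a lattice that contains `M ⊗ 1`. -/
theorem fwd1 (Q : Type) [AddCommGroup Q] [Module (R ⊗[k] DegV k) Q]
    [Module.Finite (R ⊗[k] DegV k) Q] (j : Q →+ M ⊗[k] DegK k) (hj : Function.Injective j)
    (hjc : ∀ (r : R) (v : DegV k) (q : Q),
      j ((r ⊗ₜ[k] v) • q) = r • cA k R M (algebraMap _ _ v) (j q))
    (hjs : ∀ m, ∃ q, j q = iot k R M m)
    (π : Q →+ N) (hπs : Function.Surjective π)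
    (hπc : ∀ (r : R) (q : Q), π ((r ⊗ₜ[k] (1 : DegV k)) • q) = r • π q)
    (hπk : ∀ q, π q = 0 ↔ ∃ y : Q, q = ((1 : R) ⊗ₜ[k] degT k) • y) :
    ∃ (Z : Type) (_ : AddCommGroup Z) (_ : Module R Z), Module.Finite R Z ∧
        ∃ (φ : Z →ₗ[R] M) (ψ : Z →ₗ[R] Z) (g : M × Z →ₗ[R] N),
          Function.Injective ⇑(φ.prod ψ) ∧ Function.Surjective ⇑g ∧
          LinearMap.range (φ.prod ψ) = LinearMap.ker g ∧
          IsNilpotent (ψ : Module.End R Z) := by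
  obtain ⟨l, hl⟩ := exists_lam k
  letI : Module R Q := rRestrict k R Q
  have hjr : ∀ (r : R) (q : Q), j ((r ⊗ₜ[k] (1 : DegV k)) • q) = r • j q := by
    intro r q
    rw [hjc, map_one, map_one, Module.End.one_apply]
  have hjv : ∀ (v : DegV k) (q : Q),
      j (((1 : R) ⊗ₜ[k] v) • q) = cA k R M (algebraMap _ _ v) (j q) := by
    intro r q
    rw [hjc, one_smul]
  let j' : Q →ₗ[R] M ⊗[k] DegK k :=
    { toFun := j, map_add' := map_add j, map_smul' := hjr }
  have hj' : ∀ q, j' q = j q := fun q => rfl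
  let π' : Q →ₗ[R] N :=
    { toFun := π, map_add' := map_add π, map_smul' := hπc }
  have hπ' : ∀ q, π' q = π q := fun q => rfl
  let P : Submodule R (M ⊗[k] DegK k) := LinearMap.range j'
  let e : Q ≃ₗ[R] P := LinearEquiv.ofInjective j' hj
  have he : ∀ q, ((e q : P) : M ⊗[k] DegK k) = j q := fun q => rfl
  have hPv : ∀ v : DegV k, ∀ x ∈ P, cA k R M (algebraMap _ _ v) x ∈ P := by
    rintro v _ ⟨q, rfl⟩
    exact ⟨((1 : R) ⊗ₜ[k] v) • q, hjv v q⟩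
  have hLP : LL k R M ≤ P := by
    apply LL_ind
    · exact P.zero_mem
    · intro x _ y _ hx hy; exact P.add_mem hx hy
    · intro m v
      obtain ⟨q, hq⟩ := hjs m
      have := hPv v (iot k R M m) ⟨q, hq⟩
      change cA k R M _ (m ⊗ₜ[k] 1) ∈ P at this
      rwa [cA_tmul, mul_one] at this
  obtain ⟨s, hs⟩ := (Module.Finite.fg_top : (⊤ : Submodule (R ⊗[k] DegV k) Q).FG)
  obtain ⟨n, hn⟩ := unif s (fun n q => cA k R M (tK k ^ n) (j q) ∈ LL k R M)
    (fun q => W_pow k R M (j q))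
  have hnQ : ∀ q, cA k R M (tK k ^ n) (j q) ∈ LL k R M := by
    intro q
    have hq : q ∈ Submodule.span (R ⊗[k] DegV k) (s : Set Q) := by rw [hs]; trivial
    induction hq using Submodule.span_induction with
    | mem x hx => exact hn x hx
    | zero => rw [map_zero, map_zero]; exact Submodule.zero_mem _
    | add x y _ _ hx hy => rw [map_add, map_add]; exact Submodule.add_mem _ hx hy
    | smul a x _ hx =>
      induction a with
      | zero => rw [zero_smul, map_zero, map_zero]; exact Submodule.zero_mem _
      | add a b ha hb => rw [add_smul, map_add, map_add]; exact Submodule.add_mem _ ha hb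
      | tmul r v =>
        rw [hjc, map_smul, cA_cA, mul_comm, ← cA_cA]
        exact Submodule.smul_mem _ _ (LL_cA _ _ _ _ _ hx)
  let Y : Submodule R (M ⊗[k] DegK k) := Submodule.span R
    (Set.image2 (fun (i : ℕ) q => cA k R M (tK k ^ i) (j q)) (Set.Iio n) (s : Set Q))
  have hYfg : Y.FG := Submodule.fg_span ((Set.finite_Iio n).image2 _ s.finite_toSet)
  have hYP : Y ≤ P := by
    refine Submodule.span_le.2 ?_
    rintro _ ⟨i, _, q, _, rfl⟩
    have := hPv (degT k ^ i) (j q) ⟨q, rfl⟩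
    rwa [map_pow] at this
  have key : ∀ q ∈ s, ∀ (d i : ℕ), n ≤ i + d → ∀ v : DegV k,
      cA k R M (algebraMap _ _ v) (cA k R M (tK k ^ i) (j q)) ∈ Y ⊔ LL k R M := by
    intro q hq
    have base : ∀ i : ℕ, n ≤ i → ∀ v : DegV k,
        cA k R M (algebraMap _ _ v) (cA k R M (tK k ^ i) (j q)) ∈ Y ⊔ LL k R M := by
      intro i hi v
      obtain ⟨d, rfl⟩ := Nat.exists_eq_add_of_le hi
      apply Submodule.mem_sup_right
      rw [add_comm n d, pow_add, ← cA_cA, tK, ← map_pow, ← map_pow]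
      refine LL_cA _ _ _ _ _ (LL_cA _ _ _ _ _ ?_)
      rw [map_pow]
      exact hnQ q
    intro d
    induction d with
    | zero => exact base
    | succ d ih =>
      intro i hi v
      rcases le_or_gt n i with h | h
      · exact base i h v
      · obtain ⟨v', hv⟩ := evV_decomp k v
        rw [hv, map_add, map_add, LinearMap.add_apply]
        refine Submodule.add_mem _ ?_ ?_
        · rw [← IsScalarTower.algebraMap_apply, cA_k]
          refine Submodule.smul_mem _ _ (Submodule.mem_sup_left (Submodule.subset_span ?_))
          exact ⟨i, h, q, hq, rfl⟩
        · have := ih (i + 1) (by omega) v'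
          rw [cA_cA] at this ⊢
          have e : algebraMap (DegV k) (DegK k) (degT k * v') * tK k ^ i
              = algebraMap (DegV k) (DegK k) v' * tK k ^ (i + 1) := by
            rw [map_mul]
            change tK k * _ * _ = _
            ring
          rw [e]
          exact this
  have hPY : P ≤ Y ⊔ LL k R M := by
    rintro _ ⟨q, rfl⟩
    suffices ∀ a : R ⊗[k] DegV k, j (a • q) ∈ Y ⊔ LL k R M by
      have := this 1
      rwa [one_smul] at this
    have hq : q ∈ Submodule.span (R ⊗[k] DegV k) (s : Set Q) := by rw [hs]; trivial
    induction hq using Submodule.span_induction with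
    | mem x hx =>
      intro a
      induction a with
      | zero => rw [zero_smul, map_zero]; exact Submodule.zero_mem _
      | add a b ha hb => rw [add_smul, map_add]; exact Submodule.add_mem _ ha hb
      | tmul r v =>
        rw [hjc]
        refine Submodule.smul_mem _ _ ?_
        have := key x hx n 0 (by omega) v
        rwa [pow_zero, map_one, Module.End.one_apply] at this
    | zero => intro a; rw [smul_zero, map_zero]; exact Submodule.zero_mem _
    | add x y _ _ hx hy =>
      intro a; rw [smul_add, map_add]; exact Submodule.add_mem _ (hx a) (hy a)
    | smul b x _ hx => intro a; rw [← mul_smul]; exact hx _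
  have hfg : Module.Finite R (P ⧸ (LL k R M).submoduleOf P) := by
    haveI : Module.Finite R Y := Module.Finite.iff_fg.2 hYfg
    refine Module.Finite.of_surjective
      (((LL k R M).submoduleOf P).mkQ ∘ₗ Submodule.inclusion hYP) ?_
    intro z
    induction z using Submodule.Quotient.induction_on with
    | H x =>
    obtain ⟨y, hy, w, hw, hyw⟩ := Submodule.mem_sup.1 (hPY x.2)
    refine ⟨⟨y, hy⟩, ?_⟩
    rw [LinearMap.comp_apply, Submodule.mkQ_apply, Submodule.Quotient.eq]
    change y - (x : M ⊗[k] DegK k) ∈ LL k R M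
    rw [← hyw, sub_add_cancel_left]
    exact Submodule.neg_mem _ hw
  refine core1 (LL k R M) P (cA k R M (tK k)) (cA_inj k R M (tK_unit k)) hLP
    (hPv (degT k)) (LL_T k R M) (lam k R M l) (iot k R M) (lam_iot k R M hl) (iot_mem k R M)
    (LL_dec k R M hl) (lam_T k R M hl) n ?_ hfg (π' ∘ₗ e.symm.toLinearMap) ?_ ?_
  · rintro _ ⟨q, rfl⟩
    rw [cA_T_pow]
    exact hnQ q
  · intro y
    obtain ⟨q, rfl⟩ := hπs y
    refine ⟨e q, ?_⟩
    change π' (e.symm (e q)) = _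
    rw [LinearEquiv.symm_apply_apply, hπ']
  · intro x
    obtain ⟨q, rfl⟩ := e.surjective x
    change π' (e.symm (e q)) = 0 ↔ _
    rw [LinearEquiv.symm_apply_apply, hπ', hπk, he]
    constructor
    · rintro ⟨y, rfl⟩
      exact ⟨j y, ⟨y, rfl⟩, hjv _ _⟩
    · rintro ⟨_, ⟨y, rfl⟩, h⟩
      refine ⟨y, hj ?_⟩
      rw [hjv, h]
      rfl

theorem tInv_pow (n : ℕ) : tInv k ^ n * tK k ^ n = 1 := by
  rw [← mul_pow, mul_comm, tK_mul_tInv, one_pow]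

theorem fwd2 (Q : Type) [AddCommGroup Q] [Module (R ⊗[k] DegV k) Q]
    [Module.Finite (R ⊗[k] DegV k) Q] (j : Q →+ M ⊗[k] DegK k) (hj : Function.Injective j)
    (hjc : ∀ (r : R) (v : DegV k) (q : Q),
      j ((r ⊗ₜ[k] v) • q) = r • cA k R M (algebraMap _ _ v) (j q))
    (hjs : ∀ w, ∃ (n : ℕ) (q : Q), cA k R M (tK k ^ n) w = j q)
    (π : Q →+ N) (hπs : Function.Surjective π)
    (hπc : ∀ (r : R) (q : Q), π ((r ⊗ₜ[k] (1 : DegV k)) • q) = r • π q)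
    (hπk : ∀ q, π q = 0 ↔ ∃ y : Q, q = ((1 : R) ⊗ₜ[k] degT k) • y) :
    ∃ (Z : Type) (_ : AddCommGroup Z) (_ : Module R Z), Module.Finite R Z ∧
        ∃ (φ : Z →ₗ[R] M) (ψ : Z →ₗ[R] Z) (g : M × Z →ₗ[R] N),
          Function.Injective ⇑(φ.prod ψ) ∧ Function.Surjective ⇑g ∧
          LinearMap.range (φ.prod ψ) = LinearMap.ker g ∧
          IsNilpotent (ψ : Module.End R Z) := by
  obtain ⟨s, hs⟩ := (Module.Finite.fg_top : (⊤ : Submodule R M).FG)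
  obtain ⟨n, hn⟩ := unif s (fun n m => ∃ q, cA k R M (tK k ^ n) (iot k R M m) = j q) (by
    intro m
    obtain ⟨n, q, h⟩ := hjs (iot k R M m)
    refine ⟨n, fun n' hn => ?_⟩
    obtain ⟨d, rfl⟩ := Nat.exists_eq_add_of_le hn
    refine ⟨((1 : R) ⊗ₜ[k] (degT k ^ d)) • q, ?_⟩
    rw [hjc, ← h, one_smul, cA_cA, map_pow (algebraMap _ _), pow_add, mul_comm (tK k ^ n)]
    rfl)
  have hnM : ∀ m, ∃ q, cA k R M (tK k ^ n) (iot k R M m) = j q := by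
    intro m
    have hm : m ∈ Submodule.span R (s : Set M) := by rw [hs]; trivial
    induction hm using Submodule.span_induction with
    | mem x hx => exact hn x hx
    | zero => exact ⟨0, by simp⟩
    | add x y _ _ hx hy =>
      obtain ⟨a, ha⟩ := hx
      obtain ⟨b, hb⟩ := hy
      exact ⟨a + b, by rw [map_add, map_add, map_add, ha, hb]⟩
    | smul r x _ hx =>
      obtain ⟨a, ha⟩ := hx
      exact ⟨(r ⊗ₜ[k] (1 : DegV k)) • a, by
        rw [map_smul, map_smul, ha, hjc, map_one, map_one, Module.End.one_apply]⟩
  have hu : IsUnit (tInv k ^ n) := IsUnit.of_mul_eq_one _ (tInv_pow k n)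
  refine fwd1 k R M N Q ((cA k R M (tInv k ^ n)).toAddMonoidHom.comp j) ?_ ?_ ?_ π hπs hπc hπk
  · exact (cA_inj k R M hu).comp hj
  · intro r v q
    change cA k R M _ (j _) = r • cA k R M _ (cA k R M _ (j q))
    rw [hjc, map_smul, cA_cA, cA_cA, mul_comm]
  · intro m
    obtain ⟨q, hq⟩ := hnM m
    refine ⟨q, ?_⟩
    change cA k R M _ (j _) = _
    rw [← hq, cA_cA, tInv_pow, map_one, Module.End.one_apply]

end Fwd

section Bwd

variable (k : Type) [Field k] (R : Type) [Ring R] [Algebra k R]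
  (M : Type) [AddCommGroup M] [Module R M] [Module k M] [IsScalarTower k R M]

/-- `M ⊗ K` as a `V`-module. -/
@[reducible] def wModV : Module (DegV k) (M ⊗[k] DegK k) :=
  Module.compHom (M ⊗[k] DegK k) ((cA k R M).comp (algebraMap (DegV k) (DegK k)))

/-- `M ⊗ K` as an `R ⊗ V`-module. -/
@[reducible] def wMod : Module (R ⊗[k] DegV k) (M ⊗[k] DegK k) :=
  letI : Module (DegV k) (M ⊗[k] DegK k) := wModV k R M
  haveI : SMulCommClass R (DegV k) (M ⊗[k] DegK k) := ⟨fun r v w =>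
    (map_smul (cA k R M (algebraMap _ _ v)) r w).symm⟩
  haveI : IsScalarTower k (DegV k) (M ⊗[k] DegK k) := ⟨fun a v w => by
    change cA k R M (algebraMap _ _ (a • v)) w = a • cA k R M (algebraMap _ _ v) w
    rw [Algebra.smul_def, map_mul, ← IsScalarTower.algebraMap_apply, ← cA_cA, cA_k,
      algebraMap_smul]⟩
  TensorProduct.Algebra.module

theorem wMod_smul (r : R) (v : DegV k) (w : M ⊗[k] DegK k) :
    letI := wMod k R M
    (r ⊗ₜ[k] v) • w = r • cA k R M (algebraMap _ _ v) w := rfl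

variable (N : Type) [AddCommGroup N] [Module R N]

theorem bwd1 (P₀ : Submodule R (M ⊗[k] DegK k)) (hLP : LL k R M ≤ P₀)
    (hPv : ∀ v : DegV k, ∀ x ∈ P₀, cA k R M (algebraMap _ _ v) x ∈ P₀)
    (s : Set (M ⊗[k] DegK k)) (hsf : s.Finite) (hsP : s ⊆ P₀)
    (hs : ∀ P' : Submodule R (M ⊗[k] DegK k),
      (∀ v : DegV k, ∀ x ∈ P', cA k R M (algebraMap _ _ v) x ∈ P') → s ⊆ P' → P₀ ≤ P')
    (p : P₀ →ₗ[R] N) (hps : Function.Surjective p)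
    (hp : ∀ x : P₀, p x = 0 ↔ ∃ y ∈ P₀, (x : M ⊗[k] DegK k) = cA k R M (tK k) y) :
  ∃ (Q : Type) (_ : AddCommGroup Q) (_ : Module (R ⊗[k] DegV k) Q),
    Module.Finite (R ⊗[k] DegV k) Q ∧
    (letI := vRestrict k R Q; Module.Flat (DegV k) Q) ∧
    (letI := rRestrict k R (Q ⧸ LinearMap.range (tSmul k R Q))
     Nonempty ((Q ⧸ LinearMap.range (tSmul k R Q)) ≃ₗ[R] N)) ∧
    (letI := vRestrict k R Q
     ∃ f : LocalizedModule (Submonoid.powers (degT k)) Q ≃+ (M ⊗[k] DegK k),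
       (∀ (c : DegK k) (x : LocalizedModule (Submonoid.powers (degT k)) Q),
          f (c • x) = cA k R M c (f x)) ∧
       (∀ (r : R) (x : LocalizedModule (Submonoid.powers (degT k)) Q),
          f (LocalizedModule.map (Submonoid.powers (degT k)) (rAct k R Q r) x)
            = r • (f x))) := by
  letI iW : Module (R ⊗[k] DegV k) (M ⊗[k] DegK k) := wMod k R M
  have hrv : ∀ (r : R) (v : DegV k) (w : M ⊗[k] DegK k),
    (r ⊗ₜ[k] v) • w = r • cA k R M (algebraMap _ _ v) w := fun _ _ _ => rfl
  have hr1 : ∀ (r : R) (w : M ⊗[k] DegK k),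
    (r ⊗ₜ[k] (1 : DegV k)) • w = r • w := fun r w => by
      rw [hrv, map_one, map_one, Module.End.one_apply]
  have h1v : ∀ (v : DegV k) (w : M ⊗[k] DegK k),
    ((1 : R) ⊗ₜ[k] v) • w = cA k R M (algebraMap _ _ v) w := fun v w => by
      rw [hrv, one_smul]
  let P : Submodule (R ⊗[k] DegV k) (M ⊗[k] DegK k) :=
    { carrier := P₀
      add_mem' := P₀.add_mem
      zero_mem' := P₀.zero_mem
      smul_mem' := fun a x hx => by
        induction a with
        | zero => rw [zero_smul]; exact P₀.zero_mem
        | add a b ha hb => rw [add_smul]; exact P₀.add_mem ha hb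
        | tmul r v => rw [hrv]; exact P₀.smul_mem _ (hPv _ _ hx) }
  have hPfg : P.FG := by
    have : P = Submodule.span (R ⊗[k] DegV k) s := by
      apply le_antisymm
      · let P' : Submodule R (M ⊗[k] DegK k) :=
          { carrier := Submodule.span (R ⊗[k] DegV k) s
            add_mem' := Submodule.add_mem _
            zero_mem' := Submodule.zero_mem _
            smul_mem' := fun r x hx => by
              rw [← hr1]; exact Submodule.smul_mem _ _ hx }
        exact hs P' (fun v x hx => by
          rw [← h1v]; exact Submodule.smul_mem (Submodule.span (R ⊗[k] DegV k) s) _ hx)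
          Submodule.subset_span
      · exact Submodule.span_le.2 hsP
    rw [this]
    exact Submodule.fg_span hsf
  refine ⟨P, inferInstance, inferInstance, Module.Finite.iff_fg.2 hPfg, ?_, ?_, ?_⟩
  · letI iV : Module (DegV k) P := vRestrict k R P
    have hsm : ∀ (v : DegV k) (x : P), ((v • x : P) : M ⊗[k] DegK k)
      = cA k R M (algebraMap _ _ v) x := fun v x => h1v v x
    haveI : Module.IsTorsionFree (DegV k) P := ⟨fun v hv x y hxy => by
      have h2 := congrArg Subtype.val hxy
      change ((v • x : P) : M ⊗[k] DegK k) = ((v • y : P) : M ⊗[k] DegK k) at h2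
      rw [hsm, hsm] at h2
      exact Subtype.ext (cA_inj k R M (VK_unit k hv.ne_zero) h2)⟩
    change Module.Flat (DegV k) P
    infer_instance
  · letI iR : Module R (P ⧸ LinearMap.range (tSmul k R P)) :=
      rRestrict k R (P ⧸ LinearMap.range (tSmul k R P))
    let pA : P →+ N := { toFun := fun x => p ⟨x.1, x.2⟩
                         map_zero' := map_zero p
                         map_add' := fun x y => map_add p ⟨x.1, x.2⟩ ⟨y.1, y.2⟩ }
    have hpA : ∀ x, pA x = 0 ↔ x ∈ LinearMap.range (tSmul k R P) := by
      intro x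
      refine (hp ⟨x.1, x.2⟩).trans ?_
      constructor
      · rintro ⟨y, hy, e⟩
        exact ⟨⟨y, hy⟩, Subtype.ext ((h1v _ _).trans e.symm)⟩
      · rintro ⟨y, rfl⟩
        exact ⟨y.1, y.2, h1v _ _⟩
    let q : (P ⧸ LinearMap.range (tSmul k R P)) →+ N :=
      QuotientAddGroup.lift (LinearMap.range (tSmul k R P)).toAddSubgroup pA
        (fun x hx => (hpA x).2 hx)
    have hq : ∀ x : P, q (Submodule.Quotient.mk x) = pA x := fun x => rfl
    let q' : (P ⧸ LinearMap.range (tSmul k R P)) →ₗ[R] N :=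
      { toFun := q
        map_add' := map_add q
        map_smul' := fun r z => by
          induction z using Submodule.Quotient.induction_on with
          | H x =>
          change q (Submodule.Quotient.mk ((r ⊗ₜ[k] (1 : DegV k)) • x)) = r • q _
          rw [hq, hq]
          change p _ = r • p _
          rw [← map_smul]
          congr 1
          exact Subtype.ext (hr1 r x.1) }
    refine ⟨LinearEquiv.ofBijective q' ⟨?_, ?_⟩⟩
    · rw [← LinearMap.ker_eq_bot, LinearMap.ker_eq_bot']
      intro z
      induction z using Submodule.Quotient.induction_on with
      | H x =>
      intro h
      rw [Submodule.Quotient.mk_eq_zero]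
      exact (hpA x).1 h
    · intro y
      obtain ⟨x, rfl⟩ := hps y
      exact ⟨Submodule.Quotient.mk ⟨x.1, x.2⟩, rfl⟩
  · letI iV : Module (DegV k) P := vRestrict k R P
    letI iVW : Module (DegV k) (M ⊗[k] DegK k) := wModV k R M
    have hvw : ∀ (v : DegV k) (w : M ⊗[k] DegK k),
      v • w = cA k R M (algebraMap _ _ v) w := fun _ _ => rfl
    have hsm : ∀ (v : DegV k) (x : P), ((v • x : P) : M ⊗[k] DegK k)
      = cA k R M (algebraMap _ _ v) x := fun v x => h1v v x
    let inc : P →ₗ[DegV k] M ⊗[k] DegK k :=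
      { toFun := Subtype.val
        map_add' := fun _ _ => rfl
        map_smul' := hsm }
    have hinc : ∀ x, inc x = x.1 := fun _ => rfl
    have hu : ∀ x : Submonoid.powers (degT k), IsUnit (algebraMap (DegV k) (DegK k) x) :=
      fun x => IsLocalization.map_units _ x
    haveI : IsLocalizedModule (Submonoid.powers (degT k)) inc :=
      { map_units := by
          intro x
          rw [Module.End.isUnit_iff]
          refine ⟨fun a b h => cA_inj k R M (hu x) h, fun w => ?_⟩
          obtain ⟨d, hd⟩ := (hu x).exists_right_inv
          refine ⟨cA k R M d w, ?_⟩
          change cA k R M (algebraMap _ _ (x : DegV k)) _ = w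
          rw [cA_cA, hd, map_one, Module.End.one_apply]
        surj := by
          intro w
          obtain ⟨n, hn⟩ := W_pow k R M w
          refine ⟨(⟨_, hLP (hn n le_rfl)⟩, ⟨degT k ^ n, n, rfl⟩), ?_⟩
          change cA k R M (algebraMap _ _ (degT k ^ n)) w = _
          rw [map_pow (algebraMap (DegV k) (DegK k))]
          rfl
        exists_of_eq := fun {x y} h => ⟨1, by rw [Subtype.ext h]⟩ }
    let F : LocalizedModule (Submonoid.powers (degT k)) P ≃ₗ[DegV k] M ⊗[k] DegK k :=
      IsLocalizedModule.iso (Submonoid.powers (degT k)) inc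
    have hF : ∀ (x : P) (s : Submonoid.powers (degT k)),
        cA k R M (algebraMap _ _ (s : DegV k)) (F (LocalizedModule.mk x s)) = x.1 := by
      intro x s
      rw [IsLocalizedModule.iso_apply_mk]
      exact Module.End.isUnit_apply_inv_apply_of_isUnit
        (IsLocalizedModule.map_units inc s) (inc x)
    refine ⟨F.toAddEquiv, ?_, ?_⟩
    · intro c x
      change F (c • x) = cA k R M c (F x)
      induction x using LocalizedModule.induction_on with
      | h x s =>
      obtain ⟨v, t, hc⟩ := IsLocalization.exists_mk'_eq (Submonoid.powers (degT k)) c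
      have h1 : c • LocalizedModule.mk x s = LocalizedModule.mk (v • x) (t * s) := by
        rw [← LocalizedModule.mk_smul_mk, Localization.mk_eq_mk', ← hc]
        rfl
      have hts := IsLocalization.mk'_spec' (DegK k) v t
      rw [hc] at hts
      apply cA_inj k R M (hu (t * s))
      rw [h1, hF, hsm, cA_cA, Submonoid.coe_mul, map_mul (algebraMap (DegV k) (DegK k)),
        mul_right_comm, hts, ← cA_cA, hF]
    · intro r x
      change F (LocalizedModule.map (Submonoid.powers (degT k)) (rAct k R P r) x) = r • F x
      induction x using LocalizedModule.induction_on with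
      | h x s =>
      apply cA_inj k R M (hu s)
      rw [map_smul, hF]
      have h1 : LocalizedModule.map (Submonoid.powers (degT k)) (rAct k R P r)
        (LocalizedModule.mk x s) = LocalizedModule.mk (rAct k R P r x) s :=
        IsLocalizedModule.map_LocalizedModules _ _ _ _
      rw [h1, hF]
      exact hr1 r x

end Bwd

section Bwd2

variable (k : Type) [Field k] (R : Type) [Ring R] [Algebra k R]
  (M : Type) [AddCommGroup M] [Module R M] [Module k M] [IsScalarTower k R M]

/-- The map `z ↦ ∑ φ (ψ ^ i z) ⊗ t ^ (-i-1)`. -/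
def SS {Z : Type} [AddCommGroup Z] [Module R Z] (φ : Z →ₗ[R] M) (ψ : Z →ₗ[R] Z) (n : ℕ) :
    Z →ₗ[R] M ⊗[k] DegK k :=
  ∑ i ∈ Finset.range n, cA k R M (tInv k ^ (i + 1)) ∘ₗ iot k R M ∘ₗ φ ∘ₗ (ψ ^ i : Module.End R Z)

theorem SS_T {Z : Type} [AddCommGroup Z] [Module R Z] (φ : Z →ₗ[R] M) (ψ : Z →ₗ[R] Z) (n : ℕ)
    (hn : (ψ ^ n : Module.End R Z) = 0) (z : Z) :
    cA k R M (tK k) (SS k R M φ ψ n z) = iot k R M (φ z) + SS k R M φ ψ n (ψ z) := by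
  let f : ℕ → M ⊗[k] DegK k := fun i =>
    cA k R M (tInv k ^ i) (iot k R M (φ ((ψ ^ i : Module.End R Z) z)))
  have h1 : cA k R M (tK k) (SS k R M φ ψ n z) = ∑ i ∈ Finset.range n, f i := by
    simp only [SS, LinearMap.sum_apply, map_sum, LinearMap.comp_apply]
    refine Finset.sum_congr rfl fun i _ => ?_
    rw [cA_cA, pow_succ', ← mul_assoc, tK_mul_tInv, one_mul]
  have h2 : SS k R M φ ψ n (ψ z) = ∑ i ∈ Finset.range n, f (i + 1) := by
    simp only [SS, LinearMap.sum_apply, LinearMap.comp_apply]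
    refine Finset.sum_congr rfl fun i _ => ?_
    simp only [f]
    rw [pow_succ ψ i, Module.End.mul_apply]
  have h3 : f n = 0 := by simp [f, hn]
  have h4 : f 0 = iot k R M (φ z) := by simp [f]
  rw [h1, h2, ← h4, add_comm, ← Finset.sum_range_succ', Finset.sum_range_succ, h3, add_zero]

theorem bwd2 [Module.Finite R M] (N : Type) [AddCommGroup N] [Module R N]
    {Z : Type} [AddCommGroup Z] [Module R Z] [Module.Finite R Z]
    (φ : Z →ₗ[R] M) (ψ : Z →ₗ[R] Z) (g : M × Z →ₗ[R] N)
    (hinj : Function.Injective ⇑(φ.prod ψ)) (hsurj : Function.Surjective ⇑g)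
    (hex : LinearMap.range (φ.prod ψ) = LinearMap.ker g)
    (hnil : IsNilpotent (ψ : Module.End R Z)) :
  ∃ (Q : Type) (_ : AddCommGroup Q) (_ : Module (R ⊗[k] DegV k) Q),
    Module.Finite (R ⊗[k] DegV k) Q ∧
    (letI := vRestrict k R Q; Module.Flat (DegV k) Q) ∧
    (letI := rRestrict k R (Q ⧸ LinearMap.range (tSmul k R Q))
     Nonempty ((Q ⧸ LinearMap.range (tSmul k R Q)) ≃ₗ[R] N)) ∧
    (letI := vRestrict k R Q
     ∃ f : LocalizedModule (Submonoid.powers (degT k)) Q ≃+ (M ⊗[k] DegK k),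
       (∀ (c : DegK k) (x : LocalizedModule (Submonoid.powers (degT k)) Q),
          f (c • x) = cA k R M c (f x)) ∧
       (∀ (r : R) (x : LocalizedModule (Submonoid.powers (degT k)) Q),
          f (LocalizedModule.map (Submonoid.powers (degT k)) (rAct k R Q r) x)
            = r • (f x))) := by
  obtain ⟨l, hl⟩ := exists_lam k
  obtain ⟨n, hn⟩ := id hnil
  have hS := SS_T k R M φ ψ n hn
  set S := SS k R M φ ψ n
  obtain ⟨p, hps, hp⟩ := core2 φ ψ g hinj hsurj hex hnil (LL k R M) (cA k R M (tK k))
    (cA_inj k R M (tK_unit k)) (lam k R M l) (iot k R M) (lam_iot k R M hl) (iot_mem k R M)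
    (LL_dec k R M hl) (LL_T k R M) (lam_T k R M hl) S hS
  obtain ⟨sM, hsM⟩ := (Module.Finite.fg_top : (⊤ : Submodule R M).FG)
  obtain ⟨sZ, hsZ⟩ := (Module.Finite.fg_top : (⊤ : Submodule R Z).FG)
  have hSv : ∀ (j : ℕ) (z : Z), (ψ ^ j : Module.End R Z) z = 0 → ∀ v : DegV k,
      cA k R M (algebraMap _ _ v) (S z) ∈ LL k R M ⊔ LinearMap.range S := by
    intro j
    induction j with
    | zero =>
      intro z hz v
      have : z = 0 := hz
      rw [this, map_zero, map_zero]
      exact Submodule.zero_mem _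
    | succ j ih =>
      intro z hz v
      obtain ⟨v', hv⟩ := evV_decomp k v
      rw [hv, map_add, map_add, LinearMap.add_apply, ← IsScalarTower.algebraMap_apply, cA_k]
      refine Submodule.add_mem _
        (Submodule.smul_mem _ _ (Submodule.mem_sup_right ⟨z, rfl⟩)) ?_
      rw [mul_comm, map_mul, ← cA_cA]
      change cA k R M _ (cA k R M (tK k) _) ∈ _
      rw [hS, map_add]
      refine Submodule.add_mem _ (Submodule.mem_sup_left (LL_cA _ _ _ _ _ (iot_mem _ _ _ _))) ?_
      exact ih _ (by rw [pow_succ] at hz; exact hz) v'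
  refine bwd1 k R M N (LL k R M ⊔ LinearMap.range S) le_sup_left ?_
    ((iot k R M '' sM) ∪ (S '' sZ))
    ((sM.finite_toSet.image _).union (sZ.finite_toSet.image _)) ?_ ?_ p hps hp
  · intro v x hx
    obtain ⟨a, ha, _, ⟨z, rfl⟩, rfl⟩ := Submodule.mem_sup.1 hx
    rw [map_add]
    exact Submodule.add_mem _ (Submodule.mem_sup_left (LL_cA _ _ _ _ _ ha))
      (hSv n z (by rw [hn]; rfl) v)
  · rintro _ (⟨m, _, rfl⟩ | ⟨z, _, rfl⟩)
    · exact Submodule.mem_sup_left (iot_mem _ _ _ _)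
    · exact Submodule.mem_sup_right ⟨z, rfl⟩
  · intro P' hP' hs
    have h1 : ∀ m, iot k R M m ∈ P' := by
      have : Submodule.span R (sM : Set M) ≤ P'.comap (iot k R M) :=
        Submodule.span_le.2 fun m hm => hs (Or.inl ⟨m, hm, rfl⟩)
      intro m
      exact this (by rw [hsM]; trivial)
    have h2 : ∀ z, S z ∈ P' := by
      have : Submodule.span R (sZ : Set Z) ≤ P'.comap S :=
        Submodule.span_le.2 fun m hm => hs (Or.inr ⟨m, hm, rfl⟩)
      intro m
      exact this (by rw [hsZ]; trivial)
    refine sup_le ?_ ?_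
    · apply LL_ind
      · exact P'.zero_mem
      · intro x _ y _ hx hy; exact P'.add_mem hx hy
      · intro m v
        have := hP' v _ (h1 m)
        change cA k R M _ (m ⊗ₜ 1) ∈ P' at this
        rwa [cA_tmul, mul_one] at this
    · rintro _ ⟨z, rfl⟩
      exact h2 z

end Bwd2

/-- `M ⇒_deg N` iff there is a short exact sequence
`0 → Z → M ⊕ Z → N → 0` of finitely generated `R`-modules whose first map has
nilpotent second component `ψ : Z → Z`. -/
theorem degenerates_iff_exists_ses (k : Type) [Field k] (R : Type) [Ring R] [Algebra k R]
    (M N : Type) [AddCommGroup M] [Module R M] [Module.Finite R M]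
    [AddCommGroup N] [Module R N] [Module.Finite R N] :
    Degenerates k R M N ↔
      ∃ (Z : Type) (_ : AddCommGroup Z) (_ : Module R Z), Module.Finite R Z ∧
        ∃ (φ : Z →ₗ[R] M) (ψ : Z →ₗ[R] Z) (g : M × Z →ₗ[R] N),
          Function.Injective ⇑(φ.prod ψ) ∧ Function.Surjective ⇑g ∧
          LinearMap.range (φ.prod ψ) = LinearMap.ker g ∧
          IsNilpotent (ψ : Module.End R Z) := by
  let iM : Module k M := Module.compHom M (algebraMap k R)
  have iT : IsScalarTower k R M := ⟨fun a r m => by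
    change (a • r) • m = algebraMap k R a • (r • m)
    rw [Algebra.smul_def, mul_smul]⟩
  have hract : ∀ (r : R) (w : M ⊗[k] DegK k),
      LinearMap.rTensor (DegK k) (rActK k R M r) w = r • w := by
    intro r w
    induction w with
    | zero => rw [map_zero, smul_zero]
    | add x y hx hy => rw [map_add, smul_add, hx, hy]
    | tmul m c => rfl
  constructor
  · rintro ⟨Q, iQ, iQm, hfin, hflat, ⟨e⟩, f, hfc, hfr⟩
    let iV : Module (DegV k) Q := vRestrict k R Q
    have hflat' : Module.Flat (DegV k) Q := hflat
    have hreg : ∀ (s : Submonoid.powers (degT k)) (q : Q), s • q = 0 → q = 0 := by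
      rintro ⟨_, n, rfl⟩ q h
      have hn : degT k ^ n ≠ 0 := pow_ne_zero _ (degT_ne k)
      have := Module.Flat.isSMulRegular_of_isRegular (M := Q) (isRegular_of_ne_zero hn)
      apply this
      change _ = (degT k ^ n) • (0 : Q)
      rw [smul_zero]
      exact h
    let mk1 : Q →ₗ[DegV k] LocalizedModule (Submonoid.powers (degT k)) Q :=
      LocalizedModule.mkLinearMap (Submonoid.powers (degT k)) Q
    have hmk1 : ∀ q, mk1 q = LocalizedModule.mk q 1 := fun _ => rfl
    let j : Q →+ M ⊗[k] DegK k := f.toAddMonoidHom.comp mk1.toAddMonoidHom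
    have hj : ∀ q, j q = f (LocalizedModule.mk q 1) := fun _ => rfl
    have hjv : ∀ (v : DegV k) (q : Q),
        j (((1 : R) ⊗ₜ[k] v) • q) = cA k R M (algebraMap _ _ v) (j q) := by
      intro v q
      rw [hj, hj, cA_eq, ← hfc]
      congr 1
      refine Eq.symm (Eq.trans (LocalizedModule.mk_smul_mk (S := Submonoid.powers (degT k))
        v q 1 1) ?_)
      rw [one_mul]
      rfl
    have hjr : ∀ (r : R) (q : Q), j ((r ⊗ₜ[k] (1 : DegV k)) • q) = r • j q := by
      intro r q
      rw [hj, hj, ← hract, ← hfr]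
      congr 1
      have h1 : LocalizedModule.map (Submonoid.powers (degT k)) (rAct k R Q r)
        (LocalizedModule.mk q 1) = LocalizedModule.mk (rAct k R Q r q) 1 :=
        IsLocalizedModule.map_LocalizedModules _ _ _ _
      exact h1.symm
    let iRQ : Module R (Q ⧸ LinearMap.range (tSmul k R Q)) := rRestrict k R _
    let π : Q →+ N := e.toAddEquiv.toAddMonoidHom.comp
      (LinearMap.range (tSmul k R Q)).mkQ.toAddMonoidHom
    refine fwd2 k R M N Q j ?_ ?_ ?_ π ?_ ?_ ?_
    · rw [injective_iff_map_eq_zero]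
      intro q hq
      rw [hj, EmbeddingLike.map_eq_zero_iff] at hq
      rw [← LocalizedModule.zero_mk 1, LocalizedModule.mk_eq] at hq
      obtain ⟨u, hu⟩ := hq
      rw [smul_zero, smul_zero, one_smul] at hu
      exact hreg u q hu
    · intro r v q
      rw [← hjv, ← hjr, ← mul_smul, Algebra.TensorProduct.tmul_mul_tmul, mul_one, one_mul]
    · intro w
      obtain ⟨x, rfl⟩ := f.surjective w
      induction x using LocalizedModule.induction_on with
      | h q s =>
      obtain ⟨_, n, rfl⟩ := s
      refine ⟨n, q, ?_⟩
      rw [hj, cA_eq, ← hfc]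
      congr 1
      have h0 : tK k ^ n = algebraMap (DegV k) (DegK k) (degT k ^ n) := (map_pow _ _ _).symm
      rw [h0]
      refine Eq.trans (LocalizedModule.mk_smul_mk (S := Submonoid.powers (degT k))
        (degT k ^ n) q 1 ⟨degT k ^ n, n, rfl⟩) ?_
      rw [one_mul]
      exact LocalizedModule.mk_cancel (⟨degT k ^ n, n, rfl⟩ : Submonoid.powers (degT k)) q
    · exact e.surjective.comp (Submodule.mkQ_surjective _)
    · intro r q
      exact e.map_smul r (Submodule.Quotient.mk q)
    · intro q
      change e (Submodule.Quotient.mk q) = 0 ↔ _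
      rw [EmbeddingLike.map_eq_zero_iff, Submodule.Quotient.mk_eq_zero]
      constructor
      · rintro ⟨y, rfl⟩; exact ⟨y, rfl⟩
      · rintro ⟨y, rfl⟩; exact ⟨y, rfl⟩
  · rintro ⟨Z, iZ, iZm, hfin, φ, ψ, g, hinj, hsurj, hex, hnil⟩
    obtain ⟨Q, iQ, iQm, h1, h2, h3, f, h4, h5⟩ :=
      bwd2 k R M N φ ψ g hinj hsurj hex hnil
    exact ⟨Q, iQ, iQm, h1, h2, h3, f, h4, fun r x => (h5 r x).trans (hract r _).symm⟩
end
end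

section
/- Let k be a field, R an associative unital k-algebra, and suppose 0 → L → M → N → 0 is a short exact sequence of finitely generated left R-modules. Then M ⇒_deg L ⊕ N. -/
open Polynomial TensorProduct

noncomputable section

instance degK_tower (k : Type) [Field k] : IsScalarTower k (DegV k) (DegK k) :=
  inferInstanceAs (IsScalarTower k (DegV k) (Localization (Submonoid.powers (degT k))))

instance degK_loc (k : Type) [Field k] :
    IsLocalization (Submonoid.powers (degT k)) (DegK k) :=
  inferInstanceAs (IsLocalization (Submonoid.powers (degT k))
    (Localization (Submonoid.powers (degT k))))

instance degK_tower' (k : Type) [Field k] (Q : Type) [AddCommGroup Q] [Module (DegV k) Q] :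
    IsScalarTower (DegV k) (DegK k) (LocalizedModule (Submonoid.powers (degT k)) Q) :=
  inferInstanceAs (IsScalarTower (DegV k) (Localization (Submonoid.powers (degT k)))
    (LocalizedModule (Submonoid.powers (degT k)) Q))

/-- If `D D' = D' D = t` and `ι` is a localization at `t`, so is `ι ∘ D`. -/
theorem isLocalizedModule_comp_of_factor {A : Type} [CommRing A] (t : A) {P Q W : Type}
    [AddCommGroup P] [Module A P] [AddCommGroup Q] [Module A Q] [AddCommGroup W] [Module A W]
    (i : P →ₗ[A] W) [IsLocalizedModule (Submonoid.powers t) i]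
    (D : Q →ₗ[A] P) (D' : P →ₗ[A] Q) (h1 : ∀ p, D (D' p) = t • p) (h2 : ∀ q, D' (D q) = t • q) :
    IsLocalizedModule (Submonoid.powers t) (i ∘ₗ D) where
  map_units := IsLocalizedModule.map_units i
  surj y := by
    obtain ⟨⟨p, s⟩, hp⟩ := IsLocalizedModule.surj (Submonoid.powers t) i y
    refine ⟨⟨D' p, ⟨t, Submonoid.mem_powers t⟩ * s⟩, ?_⟩
    simp only [LinearMap.comp_apply, h1, map_smul, mul_smul]
    rw [hp]; rfl
  exists_of_eq {x y} h := by
    obtain ⟨s, hs⟩ := IsLocalizedModule.exists_of_eq (S := Submonoid.powers t) (f := i) h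
    refine ⟨s * ⟨t, Submonoid.mem_powers t⟩, ?_⟩
    have := congrArg D' hs
    simp only [Submonoid.smul_def, map_smul, h2] at this
    simpa only [mul_smul, Submonoid.smul_def] using this

theorem degenerates_of_data (k : Type) [Field k] (R : Type) [Ring R] [Algebra k R]
    (M N Q : Type) [AddCommGroup M] [Module R M] [AddCommGroup N] [Module R N]
    [AddCommGroup Q] [instV : Module (DegV k) Q] [Module (R ⊗[k] DegV k) Q]
    [instM : Module k M] (hM : Module.compHom M (algebraMap k R) = instM)
    (hV : vRestrict k R Q = instV)
    (hfin : Module.Finite (R ⊗[k] DegV k) Q)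
    (hflat : Module.Flat (DegV k) Q)
    (π : Q →+ N) (hπs : Function.Surjective π)
    (hπr : ∀ (r : R) q, π ((r ⊗ₜ[k] (1 : DegV k)) • q) = r • π q)
    (hπk : ∀ q, π q = 0 ↔ ∃ q', degT k • q' = q)
    (h : Q →ₗ[DegV k] DegK k ⊗[k] M)
    (hloc : IsLocalizedModule (Submonoid.powers (degT k)) h)
    (ρ : R → M →ₗ[k] M) (hρ : ∀ r m, ρ r m = r • m)
    (hr : ∀ (r : R) q, h ((r ⊗ₜ[k] (1 : DegV k)) • q) = LinearMap.lTensor (DegK k) (ρ r) (h q)) :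
    Degenerates k R M N := by
  subst hV hM
  refine ⟨Q, inferInstance, inferInstance, hfin, hflat, ?_, ?_⟩
  · letI := rRestrict k R (Q ⧸ LinearMap.range (tSmul k R Q))
    have hπk' : ∀ q, π q = 0 ↔ q ∈ LinearMap.range (tSmul k R Q) := hπk
    have hle : (LinearMap.range (tSmul k R Q)).toAddSubgroup ≤ π.ker := fun q hq =>
      (hπk' q).2 hq
    let π' : (Q ⧸ LinearMap.range (tSmul k R Q)) →+ N :=
      QuotientAddGroup.lift (LinearMap.range (tSmul k R Q)).toAddSubgroup π hle
    have hπ' : ∀ q, π' (Submodule.Quotient.mk q) = π q := fun q => rfl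
    let l : (Q ⧸ LinearMap.range (tSmul k R Q)) →ₗ[R] N :=
      { toFun := π'
        map_add' := map_add π'
        map_smul' := by
          intro r x
          obtain ⟨q, rfl⟩ := Submodule.Quotient.mk_surjective _ x
          have : r • (Submodule.Quotient.mk q : Q ⧸ LinearMap.range (tSmul k R Q)) =
            Submodule.Quotient.mk ((r ⊗ₜ[k] (1 : DegV k)) • q) := rfl
          rw [this, hπ', hπ', hπr]; rfl }
    refine ⟨LinearEquiv.ofBijective l ⟨?_, ?_⟩⟩
    · rw [injective_iff_map_eq_zero]
      intro x hx
      obtain ⟨q, rfl⟩ := Submodule.Quotient.mk_surjective _ x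
      rw [Submodule.Quotient.mk_eq_zero]
      exact (hπk' q).1 hx
    · intro n
      obtain ⟨q, rfl⟩ := hπs n
      exact ⟨Submodule.Quotient.mk q, rfl⟩
  · letI := vRestrict k R Q
    letI : Module k M := Module.compHom M (algebraMap k R)
    let e := IsLocalizedModule.iso (Submonoid.powers (degT k)) h
    let e' : LocalizedModule (Submonoid.powers (degT k)) Q ≃ₗ[DegK k] DegK k ⊗[k] M :=
      e.extendScalarsOfIsLocalization (Submonoid.powers (degT k)) (DegK k)
    have he : ∀ x, e' x = e x := fun x => rfl
    refine ⟨e.toAddEquiv.trans (TensorProduct.comm k (DegK k) M).toAddEquiv, ?_, ?_⟩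
    · intro c x
      change TensorProduct.comm k (DegK k) M (e' (c • x)) =
        LinearMap.lTensor M (LinearMap.mulLeft k c) (TensorProduct.comm k (DegK k) M (e' x))
      rw [map_smul]
      generalize e' x = y
      induction y with
      | zero => simp
      | tmul a b => simp [TensorProduct.smul_tmul']
      | add a b ha hb => simp only [smul_add, map_add, ha, hb]
    · intro r x
      change TensorProduct.comm k (DegK k) M (e _) =
        LinearMap.rTensor (DegK k) _ (TensorProduct.comm k (DegK k) M (e x))
      have key : e.toLinearMap ∘ₗ (LocalizedModule.map (Submonoid.powers (degT k)) (rAct k R Q r))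
          = (TensorProduct.AlgebraTensorModule.map (LinearMap.id : DegK k →ₗ[DegV k] DegK k) (ρ r))
            ∘ₗ e.toLinearMap := by
        apply IsLocalizedModule.linearMap_ext (Submonoid.powers (degT k))
          (LocalizedModule.mkLinearMap (Submonoid.powers (degT k)) Q) h
        ext q
        have h1 : LocalizedModule.map (Submonoid.powers (degT k)) (rAct k R Q r)
            (LocalizedModule.mk q 1) =
            LocalizedModule.mk ((r ⊗ₜ[k] (1 : DegV k)) • q) 1 := by
          rw [LocalizedModule.map_mk]; rfl
        change e (LocalizedModule.map (Submonoid.powers (degT k)) (rAct k R Q r)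
            (LocalizedModule.mk q 1)) = LinearMap.lTensor (DegK k) (ρ r) (e (LocalizedModule.mk q 1))
        rw [h1, IsLocalizedModule.iso_mk_one, IsLocalizedModule.iso_mk_one, hr]
      have h2 : e (LocalizedModule.map (Submonoid.powers (degT k)) (rAct k R Q r) x) =
        LinearMap.lTensor (DegK k) (ρ r) (e x) := LinearMap.congr_fun key x
      have h3 : ρ r = rActK k R M r := by
        ext m
        exact hρ r m
      rw [h2, h3]
      generalize e x = y
      induction y with
      | zero => simp
      | tmul a b => simp
      | add a b ha hb => simp only [map_add, ha, hb]


theorem exists_degV_ev (k : Type) [Field k] : ∃ ev : DegV k →ₗ[k] k, ev 1 = 1 ∧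
    Function.Exact (LinearMap.mulLeft k (degT k)) ev := by
  have hu : ∀ y : (tIdeal k).primeCompl, IsUnit (Polynomial.aeval (R := k) (0 : k) (y : k[X])) := by
    rintro ⟨y, hy⟩
    rw [isUnit_iff_ne_zero]
    intro h
    apply hy
    change y ∈ Ideal.span _
    rw [Ideal.mem_span_singleton, Polynomial.X_dvd_iff, Polynomial.coeff_zero_eq_aeval_zero]
    exact h
  haveI : IsLocalization (tIdeal k).primeCompl (DegV k) :=
    inferInstanceAs (IsLocalization (tIdeal k).primeCompl (Localization.AtPrime (tIdeal k)))
  let ev : DegV k →ₐ[k] k := IsLocalization.liftAlgHom (M := (tIdeal k).primeCompl)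
    (f := (Polynomial.aeval (R := k) (0 : k))) hu
  have hev : ∀ p : k[X], ev (algebraMap _ _ p) = Polynomial.aeval (R := k) (0 : k) p := fun p => by
    simp [ev]
  refine ⟨ev.toLinearMap, map_one ev, ?_⟩
  intro v
  constructor
  · intro hv
    obtain ⟨⟨a, s⟩, h⟩ := IsLocalization.surj (tIdeal k).primeCompl v
    have ha : Polynomial.aeval (R := k) (0 : k) a = 0 := by
      rw [← hev, ← h, map_mul]
      have : ev v = 0 := hv
      rw [this, zero_mul]
    rw [← Polynomial.coeff_zero_eq_aeval_zero, ← Polynomial.X_dvd_iff] at ha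
    obtain ⟨b, rfl⟩ := ha
    refine ⟨IsLocalization.mk' (DegV k) b s, ?_⟩
    change degT k * _ = v
    have hs := IsLocalization.map_units (DegV k) s
    rw [← hs.mul_left_inj, mul_assoc, IsLocalization.mk'_spec, h, map_mul]
    rfl
  · rintro ⟨w, rfl⟩
    change ev (degT k * w) = 0
    rw [map_mul, degT, hev]
    simp

/-- The diagonal part of the action. -/
abbrev diagAct (k R P : Type) [Field k] [Ring R] [Algebra k R] [AddCommGroup P] [Module R P]
    [Module k P] [IsScalarTower k R P] : R →ₐ[k] Module.End k P := Algebra.lsmul k k P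

/-- `φ r = A r + t B r`. -/
def twist (k : Type) [Field k] (R P : Type) [Ring R] [Algebra k R] [AddCommGroup P] [Module R P]
    [Module k P] [IsScalarTower k R P] (B : R →ₗ[k] Module.End k P)
    (hB1 : B 1 = 0)
    (hBB : ∀ r s p, B r (B s p) = 0)
    (hBm : ∀ r s p, B (r * s) p = r • B s p + B r (s • p)) :
    R →ₐ[k] Module.End (DegV k) (DegV k ⊗[k] P) :=
  AlgHom.ofLinearMap
    { toFun := fun r => (diagAct k R P r).baseChange (DegV k) + degT k • (B r).baseChange (DegV k)
      map_add' := fun r s => by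
        rw [map_add, map_add, LinearMap.baseChange_add, LinearMap.baseChange_add, smul_add]; abel
      map_smul' := fun c s => by
        rw [map_smul, map_smul, LinearMap.baseChange_smul, LinearMap.baseChange_smul,
          RingHom.id_apply, smul_add, smul_comm c] }
    (by
      ext p
      simp [hB1])
    (fun r s => by
      ext p
      simp only [AlgebraTensorModule.curry_apply, LinearMap.restrictScalars_self, curry_apply,
        LinearMap.coe_restrictScalars, LinearMap.coe_mk, AddHom.coe_mk, LinearMap.add_apply,
        LinearMap.baseChange_tmul, LinearMap.smul_apply, Module.End.mul_apply, map_add, map_smul,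
        Algebra.lsmul_coe, hBB, hBm, tmul_zero, smul_zero, tmul_add, smul_add, add_zero, mul_smul]
      abel)

theorem twist_tmul (k : Type) [Field k] (R P : Type) [Ring R] [Algebra k R] [AddCommGroup P]
    [Module R P] [Module k P] [IsScalarTower k R P] (B : R →ₗ[k] Module.End k P)
    (hB1 : B 1 = 0)
    (hBB : ∀ r s p, B r (B s p) = 0)
    (hBm : ∀ r s p, B (r * s) p = r • B s p + B r (s • p)) (r : R) (v : DegV k) (p : P) :
    twist k R P B hB1 hBB hBm r (v ⊗ₜ p) = v ⊗ₜ (r • p) + degT k • (v ⊗ₜ B r p) := rfl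


/-- The localization map `V ⊗ M → K ⊗ M`. -/
def iotaVK (k : Type) [Field k] (M : Type) [AddCommGroup M] [Module k M] :
    DegV k ⊗[k] M →ₗ[DegV k] DegK k ⊗[k] M :=
  AlgebraTensorModule.map (Algebra.linearMap (DegV k) (DegK k)) LinearMap.id

theorem iotaVK_loc (k : Type) [Field k] (M : Type) [AddCommGroup M] [Module k M] :
    IsLocalizedModule (Submonoid.powers (degT k)) (iotaVK k M) := by
  rw [isLocalizedModule_iff_isBaseChange (Submonoid.powers (degT k)) (DegK k)]
  refine IsBaseChange.of_equiv (AlgebraTensorModule.cancelBaseChange k (DegV k) (DegK k) (DegK k) M)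
    ?_
  intro x
  induction x with
  | zero => simp
  | tmul a b => simp [iotaVK, Algebra.smul_def]
  | add a b ha hb => simp only [tmul_add, map_add, ha, hb]

theorem exists_splitting (k L M N : Type) [Field k] [AddCommGroup L] [Module k L]
    [AddCommGroup M] [Module k M] [AddCommGroup N] [Module k N]
    (f : L →ₗ[k] M) (g : M →ₗ[k] N)
    (hinj : Function.Injective ⇑f) (hsurj : Function.Surjective ⇑g)
    (hexact : LinearMap.range f = LinearMap.ker g) :
    ∃ (s : M →ₗ[k] L) (σ : N →ₗ[k] M), (∀ l, s (f l) = l) ∧ (∀ n, g (σ n) = n) ∧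
      (∀ n, s (σ n) = 0) ∧ ∀ m, f (s m) + σ (g m) = m := by
  obtain ⟨s, hs⟩ := LinearMap.exists_leftInverse_of_injective f (LinearMap.ker_eq_bot.2 hinj)
  obtain ⟨τ, hτ⟩ := LinearMap.exists_rightInverse_of_surjective g (LinearMap.range_eq_top.2 hsurj)
  have hs : ∀ l, s (f l) = l := LinearMap.congr_fun hs
  have hτ : ∀ l, g (τ l) = l := LinearMap.congr_fun hτ
  have hgf : ∀ l, g (f l) = 0 := fun l => by
    rw [← LinearMap.mem_ker, ← hexact]; exact ⟨l, rfl⟩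
  refine ⟨s, τ - f ∘ₗ s ∘ₗ τ, hs, fun n => by simp [hgf, hτ], fun n => by simp [hs], fun m => ?_⟩
  have : m - τ (g m) ∈ LinearMap.range f := by
    rw [hexact, LinearMap.mem_ker, map_sub, hτ, sub_self]
  obtain ⟨l, hl⟩ := this
  have h2 := congrArg s hl
  rw [hs, map_sub] at h2
  simp only [LinearMap.sub_apply, LinearMap.comp_apply]
  rw [h2, map_sub] at hl
  rw [← sub_eq_zero]
  rw [← sub_eq_zero] at hl
  rw [← hl]; abel

/-- a short exact sequence `0 → L → M → N → 0` yields the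
degeneration `M ⇒_deg L ⊕ N`. -/
theorem degenerates_of_ses (k : Type) [Field k] (R : Type) [Ring R] [Algebra k R]
    (L M N : Type) [AddCommGroup L] [Module R L] [Module.Finite R L]
    [AddCommGroup M] [Module R M] [Module.Finite R M]
    [AddCommGroup N] [Module R N] [Module.Finite R N]
    (f : L →ₗ[R] M) (g : M →ₗ[R] N)
    (hinj : Function.Injective ⇑f) (hsurj : Function.Surjective ⇑g)
    (hexact : LinearMap.range f = LinearMap.ker g) :
    Degenerates k R M (L × N) := by
  letI : Module k L := Module.compHom L (algebraMap k R)
  letI instM : Module k M := Module.compHom M (algebraMap k R)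
  letI : Module k N := Module.compHom N (algebraMap k R)
  haveI : IsScalarTower k R L := IsScalarTower.of_algebraMap_smul fun _ _ => rfl
  haveI : IsScalarTower k R M := IsScalarTower.of_algebraMap_smul fun _ _ => rfl
  haveI : IsScalarTower k R N := IsScalarTower.of_algebraMap_smul fun _ _ => rfl
  let f' : L →ₗ[k] M := f.restrictScalars k
  let g' : M →ₗ[k] N := g.restrictScalars k
  obtain ⟨s, σ, hs, hσ, hsσ, hid⟩ := exists_splitting k L M N f' g' hinj hsurj
    (by ext x; exact SetLike.ext_iff.1 hexact x)
  have hrσ : ∀ (r : R) n, r • σ n = f (s (r • σ n)) + σ (r • n) := fun r n => by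
    have h1 := hid (r • σ n)
    have h2 : g' (r • σ n) = r • n := by
      change g (r • σ n) = _
      rw [map_smul]; exact congrArg _ (hσ n)
    rw [h2] at h1
    exact h1.symm
  let B : R →ₗ[k] Module.End k (L × N) :=
    { toFun := fun r => LinearMap.inl k L N ∘ₗ s ∘ₗ Algebra.lsmul k k M r ∘ₗ σ ∘ₗ
        LinearMap.snd k L N
      map_add' := fun r r' => by
        rw [map_add, LinearMap.add_comp, LinearMap.comp_add, LinearMap.comp_add]
      map_smul' := fun c r => by
        rw [map_smul, LinearMap.smul_comp, LinearMap.comp_smul, LinearMap.comp_smul]; rfl }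
  have hB : ∀ r p, B r p = (s (r • σ p.2), 0) := fun r p => rfl
  have hB1 : B 1 = 0 := by
    apply LinearMap.ext
    intro p
    rw [hB, one_smul, hsσ]; rfl
  have hBB : ∀ r s p, B r (B s p) = 0 := fun r s p => by
    simp [hB]
  have hBm : ∀ r r' p, B (r * r') p = r • B r' p + B r (r' • p) := fun r r' p => by
    have h1 : s (f (r • s (r' • σ p.2))) = r • s (r' • σ p.2) := hs _
    have h2 : s ((r * r') • σ p.2) = r • s (r' • σ p.2) + s (r • σ (r' • p.2)) := by
      conv_lhs => rw [mul_smul, hrσ r' p.2, smul_add, map_add, ← f.map_smul, h1]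
    rw [hB, hB, hB, h2]
    ext
    · rfl
    · simp
  let φ := twist k R (L × N) B hB1 hBB hBm
  have hφ : ∀ r v p, φ r (v ⊗ₜ p) = v ⊗ₜ (r • p) + degT k • (v ⊗ₜ B r p) := fun r v p => rfl
  let Φ : R ⊗[k] DegV k →ₐ[k] Module.End (DegV k) (DegV k ⊗[k] (L × N)) :=
    Algebra.TensorProduct.lift φ ((Algebra.ofId (DegV k) (Module.End (DegV k) (DegV k ⊗[k] (L × N)))).restrictScalars k)
      (fun r v => (Algebra.commutes v (φ r)).symm)
  letI : Module (R ⊗[k] DegV k) (DegV k ⊗[k] (L × N)) := Module.compHom (DegV k ⊗[k] (L × N)) Φ.toRingHom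
  have hsm : ∀ (r : R) (v : DegV k) (q : (DegV k ⊗[k] (L × N))), (r ⊗ₜ[k] v) • q = φ r (v • q) := fun r v q => rfl
  have hsr : ∀ (r : R) (q : (DegV k ⊗[k] (L × N))), (r ⊗ₜ[k] (1 : DegV k)) • q = φ r q := fun r q => by
    rw [hsm, one_smul]
  have hsv : ∀ (v : DegV k) (q : (DegV k ⊗[k] (L × N))), ((1 : R) ⊗ₜ[k] v) • q = v • q := fun v q => by
    rw [hsm, map_one]; rfl
  obtain ⟨ev, hev1, hev⟩ := exists_degV_ev k
  let π : (DegV k ⊗[k] (L × N)) →ₗ[k] L × N := (TensorProduct.lid k (L × N)).toLinearMap ∘ₗ ev.rTensor (L × N)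
  have hπ : ∀ v p, π (v ⊗ₜ p) = ev v • p := fun v p => rfl
  have hevt : ∀ w, ev (degT k * w) = 0 := fun w => (hev _).2 ⟨w, rfl⟩
  have hevs : Function.Surjective ev := fun c => ⟨c • 1, by simp [hev1]⟩
  let D : (DegV k ⊗[k] (L × N)) →ₗ[DegV k] DegV k ⊗[k] M :=
    (f' ∘ₗ LinearMap.fst k L N).baseChange (DegV k) +
      degT k • (σ ∘ₗ LinearMap.snd k L N).baseChange (DegV k)
  have hD : ∀ v p, D (v ⊗ₜ p) = v ⊗ₜ f p.1 + degT k • (v ⊗ₜ σ p.2) := fun v p => rfl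
  let D' : DegV k ⊗[k] M →ₗ[DegV k] (DegV k ⊗[k] (L × N)) :=
    degT k • (LinearMap.inl k L N ∘ₗ s).baseChange (DegV k) +
      (LinearMap.inr k L N ∘ₗ g').baseChange (DegV k)
  have hD' : ∀ v m, D' (v ⊗ₜ m) = degT k • (v ⊗ₜ (s m, 0)) + v ⊗ₜ (0, g m) := fun v p => rfl
  have hgf : ∀ l, g (f l) = 0 := fun l => by
    rw [← LinearMap.mem_ker, ← hexact]; exact ⟨l, rfl⟩
  refine degenerates_of_data k R M (L × N) (DegV k ⊗[k] (L × N)) rfl ?_ ?_ inferInstance π.toAddMonoidHom ?_ ?_ ?_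
    (iotaVK k M ∘ₗ D) ?_ (fun r => Algebra.lsmul k k M r) (fun _ _ => rfl) ?_
  · refine Module.ext' _ _ ?_
    intro v q
    exact hsv v q
  · -- finiteness
    obtain ⟨S, hS⟩ := (Module.Finite.fg_top : (⊤ : Submodule R L).FG)
    obtain ⟨T, hT⟩ := (Module.Finite.fg_top : (⊤ : Submodule R N).FG)
    let W : Submodule (R ⊗[k] DegV k) (DegV k ⊗[k] (L × N)) := Submodule.span _
      ((fun l => (1 : DegV k) ⊗ₜ[k] ((l, 0) : L × N)) '' (S : Set L) ∪
        (fun n => (1 : DegV k) ⊗ₜ[k] ((0, n) : L × N)) '' (T : Set N))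
    have hWv : ∀ (v : DegV k) (q : (DegV k ⊗[k] (L × N))), q ∈ W → v • q ∈ W := fun v q hq => by
      rw [← hsv]; exact W.smul_mem _ hq
    have hWr : ∀ (r : R) (q : (DegV k ⊗[k] (L × N))), q ∈ W → φ r q ∈ W := fun r q hq => by
      rw [← hsr]; exact W.smul_mem _ hq
    have hWL : ∀ l : L, (1 : DegV k) ⊗ₜ[k] ((l, 0) : L × N) ∈ W := by
      intro l
      have hl : l ∈ Submodule.span R (S : Set L) := hS ▸ Submodule.mem_top
      induction hl using Submodule.span_induction with
      | mem x hx => exact Submodule.subset_span (Or.inl ⟨x, hx, rfl⟩)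
      | zero => 
        have : ((0, 0) : L × N) = 0 := rfl
        rw [this, tmul_zero]; exact W.zero_mem
      | add x y _ _ hx hy =>
        have : ((x + y, 0) : L × N) = (x, 0) + (y, 0) := by simp
        rw [this, tmul_add]; exact W.add_mem hx hy
      | smul r x _ hx =>
        have := hWr r _ hx
        have h0 : B r (x, 0) = 0 := by rw [hB]; simp
        rw [hφ, h0, tmul_zero, smul_zero, add_zero] at this
        simpa using this
    have hWN : ∀ n : N, (1 : DegV k) ⊗ₜ[k] ((0, n) : L × N) ∈ W := by
      intro n
      have hn : n ∈ Submodule.span R (T : Set N) := hT ▸ Submodule.mem_top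
      induction hn using Submodule.span_induction with
      | mem x hx => exact Submodule.subset_span (Or.inr ⟨x, hx, rfl⟩)
      | zero => 
        have : ((0, 0) : L × N) = 0 := rfl
        rw [this, tmul_zero]; exact W.zero_mem
      | add x y _ _ hx hy =>
        have : ((0, x + y) : L × N) = (0, x) + (0, y) := by simp
        rw [this, tmul_add]; exact W.add_mem hx hy
      | smul r x _ hx =>
        have := hWr r _ hx
        rw [hφ, hB, W.add_mem_iff_left (hWv _ _ (hWL _))] at this
        simpa using this
    have hW : W = ⊤ := by
      rw [eq_top_iff]
      intro q _
      induction q with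
      | zero => exact W.zero_mem
      | add a b ha hb => exact W.add_mem (ha trivial) (hb trivial)
      | tmul v p =>
        have h1 := hWv v _ (W.add_mem (hWL p.1) (hWN p.2))
        rw [← tmul_add, smul_tmul'] at h1
        simpa using h1
    refine ⟨?_⟩
    rw [← hW]
    exact Submodule.fg_span ((S.finite_toSet.image _).union (T.finite_toSet.image _))
  · intro p
    exact ⟨(1 : DegV k) ⊗ₜ p, by change π ((1 : DegV k) ⊗ₜ p) = p; rw [hπ, hev1, one_smul]⟩
  · intro r q
    change π _ = r • π q
    rw [hsr]
    induction q with
    | zero => simp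
    | add a b ha hb => simp only [map_add, smul_add, ha, hb]
    | tmul v p =>
      rw [hφ, map_add, smul_tmul', hπ, hπ, hπ, smul_eq_mul, hevt, zero_smul, add_zero,
        smul_comm]
  · intro q
    have hex := rTensor_exact (L × N) hev hevs q
    have h1 : π q = 0 ↔ ev.rTensor (L × N) q = 0 :=
      (TensorProduct.lid k (L × N)).map_eq_zero_iff
    change π q = 0 ↔ _
    rw [h1, hex]
    have h2 : ∀ q', (LinearMap.mulLeft k (degT k)).rTensor (L × N) q' = degT k • q' := by
      intro q'
      induction q' with
      | zero => simp
      | add a b ha hb => simp only [map_add, smul_add, ha, hb]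
      | tmul v p => rfl
    simp only [Set.mem_range, h2]
  · haveI := iotaVK_loc k M
    refine isLocalizedModule_comp_of_factor (degT k) (iotaVK k M) D D' ?_ ?_
    · intro p
      induction p with
      | zero => simp
      | add a b ha hb => simp only [map_add, smul_add, ha, hb]
      | tmul v m =>
        rw [hD', map_add, map_smul, hD, hD]
        simp only [map_zero, tmul_zero, smul_zero, add_zero, zero_add]
        rw [← smul_add, ← tmul_add]
        exact congrArg (fun x => degT k • v ⊗ₜ[k] x) (hid m)
    · intro q
      induction q with
      | zero => simp
      | add a b ha hb => simp only [map_add, smul_add, ha, hb]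
      | tmul v p =>
        have h1 : s (f p.1) = p.1 := hs _
        have h2 : g (σ p.2) = p.2 := hσ _
        rw [hD, map_add, map_smul, hD', hD', h1, h2, hgf, hsσ]
        have : ((0, 0) : L × N) = 0 := rfl
        rw [this, tmul_zero, smul_zero, add_zero, zero_add, ← smul_add, ← tmul_add]
        simp
  · intro r q
    rw [hsr]
    have h1 : D (φ r q) = (Algebra.lsmul k k M r).baseChange (DegV k) (D q) := by
      induction q with
      | zero => simp
      | add a b ha hb => simp only [map_add, ha, hb]
      | tmul v p =>
        have h3 : (Algebra.lsmul k k M r).baseChange (DegV k) (D (v ⊗ₜ p)) =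
            v ⊗ₜ (r • f p.1) + degT k • (v ⊗ₜ (r • σ p.2)) := by
          rw [hD, map_add, LinearMap.map_smul]; rfl
        have h4 : r • σ p.2 = f (B r p).1 + σ (r • p.2) := hrσ r p.2
        have h5 : (B r p).2 = 0 := rfl
        rw [h3, h4, hφ, map_add, LinearMap.map_smul, hD, hD, h5]
        simp only [map_zero, tmul_zero, smul_zero, add_zero, tmul_add, smul_add, Prod.smul_fst,
          Prod.smul_snd, f.map_smul]
        abel
    rw [LinearMap.comp_apply, h1, LinearMap.comp_apply]
    generalize D q = y
    induction y with
    | zero => simp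
    | add a b ha hb => simp only [map_add, ha, hb]
    | tmul v m => rfl
end
end
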